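/- arXiv:2104.02440 — 5 statements merged into one kernel-verified Lean document; each statement's English description precedes it below -/
import Mathlib

section
/- For any integer n with 4 ≤ n ≤ 14, t(n) ≤ n + 1 if 4 ≤ n ≤ 6, and t(n) ≤ 7 if 7 ≤ n ≤ 14. -/
/-- The value of the integral quadratic form given by the symmetric matrix `M`
at the integer vector `x`: `∑ i j, M i j * x i * x j`. -/
def QFval {k : ℕ} (M : Matrix (Fin k) (Fin k) ℤ) (x : Fin k → ℤ) : ℤ :=
  ∑ i, ∑ j, M i j * x i * x j

/-- The quadratic form given by `M` is positive definite. -/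
def QFPosDef {k : ℕ} (M : Matrix (Fin k) (Fin k) ℤ) : Prop :=
  ∀ x : Fin k → ℤ, x ≠ 0 → 0 < QFval M x

/-- The integer `m` is represented by the quadratic form given by `M`. -/
def QFRep {k : ℕ} (M : Matrix (Fin k) (Fin k) ℤ) (m : ℤ) : Prop :=
  ∃ x : Fin k → ℤ, QFval M x = m

/-- The quadratic form given by `M` is tight `T(n)`-universal: the set of nonzero
integers it represents is exactly the set of integers `≥ n`. -/
def QFTight (n : ℕ) {k : ℕ} (M : Matrix (Fin k) (Fin k) ℤ) : Prop :=
  ∀ m : ℤ, m ≠ 0 → (QFRep M m ↔ (n : ℤ) ≤ m)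

/-- positive ternary forms of determinant one that represent `N` -/
def G3 (N a b c r s t : ℤ) : Prop :=
  0 < a ∧ 0 < a * b - t ^ 2 ∧ a * b * c + 2 * r * s * t - a * r ^ 2 - b * s ^ 2 - c * t ^ 2 = 1 ∧
  ∃ x y z : ℤ, a * x ^ 2 + b * y ^ 2 + c * z ^ 2 + 2 * r * y * z + 2 * s * x * z + 2 * t * x * y = N

lemma G3_xy {N a b c r s t : ℤ} (h : G3 N a b c r s t) (k : ℤ) :
    G3 N a (b + 2 * k * t + k ^ 2 * a) c (r + k * s) s (t + k * a) := by
  obtain ⟨h1, h2, h3, x, y, z, h4⟩ := h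
  refine ⟨h1, ?_, ?_, x - k * y, y, z, ?_⟩
  · linear_combination h2
  · linear_combination h3
  · linear_combination h4

lemma G3_xz {N a b c r s t : ℤ} (h : G3 N a b c r s t) (k : ℤ) :
    G3 N a b (c + 2 * k * s + k ^ 2 * a) (r + k * t) (s + k * a) t := by
  obtain ⟨h1, h2, h3, x, y, z, h4⟩ := h
  refine ⟨h1, h2, ?_, x - k * z, y, z, ?_⟩
  · linear_combination h3
  · linear_combination h4

lemma G3_yz {N a b c r s t : ℤ} (h : G3 N a b c r s t) (k : ℤ) :
    G3 N a b (c + 2 * k * r + k ^ 2 * b) (r + k * b) (s + k * t) t := by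
  obtain ⟨h1, h2, h3, x, y, z, h4⟩ := h
  refine ⟨h1, h2, ?_, x, y - k * z, z, ?_⟩
  · linear_combination h3
  · linear_combination h4

lemma G3_swap12 {N a b c r s t : ℤ} (h : G3 N a b c r s t) : G3 N b a c s r t := by
  obtain ⟨h1, h2, h3, x, y, z, h4⟩ := h
  refine ⟨?_, ?_, ?_, y, x, z, ?_⟩
  · nlinarith [sq_nonneg t]
  · linear_combination h2
  · linear_combination h3
  · linear_combination h4

lemma G3_swap23 {N a b c r s t : ℤ} (h : G3 N a b c r s t) : G3 N a c b r t s := by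
  obtain ⟨h1, h2, h3, x, y, z, h4⟩ := h
  refine ⟨h1, ?_, ?_, x, z, y, ?_⟩
  · have : (a * b - t ^ 2) * (a * c - s ^ 2) = a + (a * r - s * t) ^ 2 := by
      linear_combination a * h3
    have h5 : 0 < (a * b - t ^ 2) * (a * c - s ^ 2) := by rw [this]; positivity
    exact pos_of_mul_pos_right h5 h2.le
  · linear_combination h3
  · linear_combination h4

lemma ex_shift (a t : ℤ) (ha : 0 < a) : ∃ k : ℤ, -a ≤ 2 * (t + k * a) ∧ 2 * (t + k * a) ≤ a := by
  refine ⟨-((2 * t + a) / (2 * a)), ?_⟩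
  have h1 := Int.emod_add_mul_ediv (2 * t + a) (2 * a)
  have h2 := Int.emod_nonneg (2 * t + a) (show 2 * a ≠ 0 by omega)
  have h3 := Int.emod_lt_of_pos (2 * t + a) (show 0 < 2 * a by omega)
  constructor <;> nlinarith

lemma G3_three {N a b c r s t : ℤ} (h : G3 N a b c r s t) :
    ∃ x y z : ℤ, x ^ 2 + y ^ 2 + z ^ 2 = N := by
  classical
  have e1 : ∃ n : ℕ, ∃ b c r s t : ℤ, G3 N n b c r s t :=
    ⟨a.toNat, b, c, r, s, t, by rwa [Int.toNat_of_nonneg h.1.le]⟩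
  obtain ⟨b0, c0, r0, s0, t0, h0⟩ := Nat.find_spec e1
  have m1 : ∀ a b c r s t, G3 N a b c r s t → (Nat.find e1 : ℤ) ≤ a := by
    intro a b c r s t h
    have := Nat.find_min' e1 (m := a.toNat) ⟨b, c, r, s, t, by rwa [Int.toNat_of_nonneg h.1.le]⟩
    have := h.1
    omega
  generalize (Nat.find e1 : ℤ) = a0 at h0 m1
  clear e1 h
  have e2 : ∃ n : ℕ, ∃ b c r s t : ℤ, G3 N a0 b c r s t ∧ a0 * b - t ^ 2 = n :=
    ⟨(a0 * b0 - t0 ^ 2).toNat, b0, c0, r0, s0, t0, h0, by rw [Int.toNat_of_nonneg h0.2.1.le]⟩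
  obtain ⟨b1, c1, r1, s1, t1, h1, g1⟩ := Nat.find_spec e2
  have m2 : ∀ b c r s t, G3 N a0 b c r s t → (Nat.find e2 : ℤ) ≤ a0 * b - t ^ 2 := by
    intro b c r s t h
    have := Nat.find_min' e2 (m := (a0 * b - t ^ 2).toNat)
      ⟨b, c, r, s, t, h, by rw [Int.toNat_of_nonneg h.2.1.le]⟩
    have := h.2.1
    omega
  generalize (Nat.find e2 : ℤ) = g at g1 m2
  clear e2 h0
  have ha := h1.1
  have hg : 0 < g := g1 ▸ h1.2.1
  obtain ⟨k, hk1, hk2⟩ := ex_shift g (a0 * r1 - s1 * t1) hg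
  have h2 := G3_yz h1 k
  obtain ⟨l, hl1, hl2⟩ := ex_shift a0 t1 ha
  have h3 := G3_xy h2 l
  obtain ⟨q, hq1, hq2⟩ := ex_shift a0 (s1 + k * t1) ha
  have h4 := G3_xz h3 q
  have g4 : a0 * (b1 + 2 * l * t1 + l ^ 2 * a0) - (t1 + l * a0) ^ 2 = g := by
    linear_combination g1
  have g12 : a0 * (r1 + k * b1 + l * (s1 + k * t1) + q * (t1 + l * a0))
      - (s1 + k * t1 + q * a0) * (t1 + l * a0) = (a0 * r1 - s1 * t1) + k * g := by
    linear_combination k * g1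
  rw [← g12] at hk1 hk2
  revert h4 g4 hk1 hk2 hl1 hl2 hq1 hq2
  generalize b1 + 2 * l * t1 + l ^ 2 * a0 = B
  generalize r1 + k * b1 + l * (s1 + k * t1) + q * (t1 + l * a0) = R
  generalize s1 + k * t1 + q * a0 = S
  generalize t1 + l * a0 = T
  generalize c1 + 2 * k * r1 + k ^ 2 * b1 + 2 * q * (s1 + k * t1) + q ^ 2 * a0 = C
  intro hk1 hk2 hl1 hl2 hq1 hq2 h4 g4
  have i1 := m1 _ _ _ _ _ _ (G3_swap12 h4)
  have i2 := m2 _ _ _ _ _ (G3_swap23 h4)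
  obtain ⟨-, -, h5, x, y, z, h6⟩ := h4
  have j1 : g * (a0 * C - S ^ 2) = a0 + (a0 * R - S * T) ^ 2 := by
    rw [← g4]; linear_combination a0 * h5
  have j2 : 4 * (a0 * R - S * T) ^ 2 ≤ g ^ 2 := by nlinarith
  have j3 : 3 * g ^ 2 ≤ 4 * a0 := by nlinarith
  have j4 : 4 * T ^ 2 ≤ a0 ^ 2 := by nlinarith
  have j5 : 3 * a0 ^ 2 ≤ 4 * g := by nlinarith
  have j6 : a0 = 1 := by
    by_contra hne
    have : 2 ≤ a0 := by omega
    have j7 : a0 ≤ g := by nlinarith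
    nlinarith
  subst j6
  have hT : T = 0 := by omega
  have hS : S = 0 := by omega
  subst hT hS
  have hg1 : g = 1 := by nlinarith
  subst hg1
  have hB : B = 1 := by linarith
  subst hB
  have hR : R = 0 := by omega
  subst hR
  have hC : C = 1 := by linarith
  subst hC
  exact ⟨x, y, z, by linear_combination h6⟩

lemma three_sq (N : ℕ) (hN : N % 4 = 2) : ∃ x y z : ℤ, x ^ 2 + y ^ 2 + z ^ 2 = N := by
  have hcop : (N - 1).Coprime (4 * N) := by
    have h1 : (N - 1).Coprime N := by
      have := (Nat.coprime_self_sub_left (n := N) (m := 1) (by omega)).2 (Nat.coprime_one_left N)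
      exact this
    have h2 : (N - 1).Coprime 4 := by
      have : (N - 1).Coprime (2 ^ 2) := Nat.Coprime.pow_right 2 (Nat.coprime_two_right.2 (by
        rw [Nat.odd_iff]; omega))
      exact this
    exact Nat.Coprime.mul_right h2 h1
  obtain ⟨p, hpN, hp, hmod⟩ := Nat.forall_exists_prime_gt_and_modEq (4 * N) (q := 4 * N) (a := N - 1)
    (by omega) hcop
  have hdvd := (Nat.modEq_iff_dvd' (by omega)).1 hmod.symm
  obtain ⟨j, hj⟩ := hdvd
  have hpj : p + 1 = N * (4 * j + 1) := by
    have : p = 4 * N * j + (N - 1) := by omega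
    rw [this]; rw [show 4 * N * j + (N - 1) + 1 = 4 * N * j + N by omega]; ring
  have hp4 : p % 4 = 1 := by
    have : p = 4 * (N * j) + (N - 1) := by rw [← mul_assoc]; omega
    omega
  have : Fact p.Prime := ⟨hp⟩
  set b := 4 * j + 1 with hb
  have hJ : jacobiSym (-(b : ℤ)) p = 1 := by
    rw [neg_eq_neg_one_mul, jacobiSym.mul_left, jacobiSym.at_neg_one (Nat.odd_iff.2 (by omega)),
      ZMod.χ₄_nat_one_mod_four hp4, one_mul,
      jacobiSym.quadratic_reciprocity_one_mod_four' (Nat.odd_iff.2 (by omega)) hp4]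
    have : jacobiSym (p : ℤ) b = jacobiSym (-1) b := by
      apply jacobiSym.mod_left'
      apply Int.ModEq.symm
      rw [Int.modEq_iff_dvd]
      have h7 : ((p + 1 : ℕ) : ℤ) = (N * b : ℕ) := by rw [hpj]
      push_cast at h7
      exact ⟨N, by linarith⟩
    rw [this, jacobiSym.at_neg_one (Nat.odd_iff.2 (by omega)),
      ZMod.χ₄_nat_one_mod_four (by omega)]
  rw [← jacobiSym.legendreSym.to_jacobiSym] at hJ
  have hne : ((-(b : ℤ) : ℤ) : ZMod p) ≠ 0 := by
    intro h0
    rw [(legendreSym.eq_zero_iff p _).2 h0] at hJ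
    exact absurd hJ (by norm_num)
  obtain ⟨w, hw⟩ := (legendreSym.eq_one_iff p hne).1 hJ
  have hd : (p : ℤ) ∣ (w.val : ℤ) ^ 2 + b := by
    rw [← ZMod.intCast_zmod_eq_zero_iff_dvd _ p]
    push_cast
    rw [ZMod.natCast_val, ZMod.cast_id]
    push_cast at hw
    linear_combination -hw
  obtain ⟨a, ha⟩ := hd
  have hpp : (0 : ℤ) < p := by exact_mod_cast hp.pos
  have hbp : (0 : ℤ) < b := by exact_mod_cast (by omega)
  have hpj' : (p : ℤ) + 1 = N * b := by exact_mod_cast hpj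
  apply G3_three (N := N) (a := a) (b := p) (c := N) (r := 0) (s := 1) (t := w.val)
  refine ⟨?_, ?_, ?_, 0, 0, 1, ?_⟩
  · have : 0 < (p : ℤ) * a := by rw [← ha]; positivity
    exact pos_of_mul_pos_right this hpp.le
  · linarith
  · linear_combination (-(N : ℤ)) * ha - hpj'
  · ring
lemma sgn3 (x e : ℤ) (hx : x % 3 ≠ 0) (he : e % 3 ≠ 0) : ∃ a : ℤ, a ^ 2 = x ^ 2 ∧ 3 ∣ a - e := by
  by_cases h : 3 ∣ x - e
  · exact ⟨x, rfl, h⟩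
  · refine ⟨-x, by ring, ?_⟩
    have h1 : x % 3 = 1 ∨ x % 3 = 2 := by omega
    have h2 : e % 3 = 1 ∨ e % 3 = 2 := by omega
    rcases h1 with h1 | h1 <;> rcases h2 with h2 | h2 <;> omega

lemma sq3 (x : ℤ) : (x % 3 = 0 ∧ x ^ 2 % 3 = 0) ∨ (x % 3 ≠ 0 ∧ x ^ 2 % 3 = 1) := by
  have h : x % 3 = 0 ∨ x % 3 = 1 ∨ x % 3 = 2 := by omega
  rcases h with h | h | h <;> simp [pow_two, Int.mul_emod, h]

lemma three_A (N : ℤ) (h0 : 0 ≤ N) (hN : N % 12 = 2) (e f : ℤ) (he : e % 3 ≠ 0) (hf : f % 3 ≠ 0) :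
    ∃ a b c : ℤ, 3 ∣ b ∧ 3 ∣ a - e ∧ 3 ∣ c - f ∧ a ^ 2 + b ^ 2 + c ^ 2 = N := by
  lift N to ℕ using h0
  obtain ⟨x, y, z, h⟩ := three_sq N (by omega)
  have key : ∀ x y z : ℤ, x ^ 2 + y ^ 2 + z ^ 2 = N → y % 3 = 0 → x % 3 ≠ 0 → z % 3 ≠ 0 →
      ∃ a b c : ℤ, 3 ∣ b ∧ 3 ∣ a - e ∧ 3 ∣ c - f ∧ a ^ 2 + b ^ 2 + c ^ 2 = N := by
    intro x y z h hy hx hz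
    obtain ⟨a, ha, ha'⟩ := sgn3 x e hx he
    obtain ⟨c, hc, hc'⟩ := sgn3 z f hz hf
    exact ⟨a, y, c, by omega, ha', hc', by rw [ha, hc, h]⟩
  rcases sq3 x with ⟨h1, h1'⟩ | ⟨h1, h1'⟩ <;> rcases sq3 y with ⟨h2, h2'⟩ | ⟨h2, h2'⟩ <;>
    rcases sq3 z with ⟨h3, h3'⟩ | ⟨h3, h3'⟩ <;> first
    | omega
    | exact key x y z h h2 h1 h3
    | exact key y x z (by linarith) h1 h2 h3
    | exact key x z y (by linarith) h3 h1 h2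

lemma three_B (N : ℤ) (h0 : 0 ≤ N) (hN : N % 12 = 10) (f : ℤ) (hf : f % 3 ≠ 0) :
    ∃ a b c : ℤ, 3 ∣ b ∧ 3 ∣ a ∧ 3 ∣ c - f ∧ a ^ 2 + b ^ 2 + c ^ 2 = N := by
  lift N to ℕ using h0
  obtain ⟨x, y, z, h⟩ := three_sq N (by omega)
  have key : ∀ x y z : ℤ, x ^ 2 + y ^ 2 + z ^ 2 = N → y % 3 = 0 → x % 3 = 0 → z % 3 ≠ 0 →
      ∃ a b c : ℤ, 3 ∣ b ∧ 3 ∣ a ∧ 3 ∣ c - f ∧ a ^ 2 + b ^ 2 + c ^ 2 = N := by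
    intro x y z h hy hx hz
    obtain ⟨c, hc, hc'⟩ := sgn3 z f hz hf
    exact ⟨x, y, c, by omega, by omega, hc', by rw [hc, h]⟩
  rcases sq3 x with ⟨h1, h1'⟩ | ⟨h1, h1'⟩ <;> rcases sq3 y with ⟨h2, h2'⟩ | ⟨h2, h2'⟩ <;>
    rcases sq3 z with ⟨h3, h3'⟩ | ⟨h3, h3'⟩ <;> first
    | omega
    | exact key x y z h h2 h1 h3
    | exact key x z y (by linarith) h3 h1 h2
    | exact key y z x (by linarith) h3 h2 h1

def M4 : Matrix (Fin 5) (Fin 5) ℤ :=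
  !![9, 0, 0, -3, 0; 0, 9, 0, 0, 0; 0, 0, 9, 3, -3; -3, 0, 3, 5, 2; 0, 0, -3, 2, 6]

lemma M4_val (x : Fin 5 → ℤ) : QFval M4 x = (3 * x 0 - x 3) ^ 2 + 9 * x 1 ^ 2 +
    (3 * x 2 + x 3 - x 4) ^ 2 + 3 * (x 3 + x 4) ^ 2 + 2 * x 4 ^ 2 := by
  simp [QFval, M4, Fin.sum_univ_succ]
  ring

lemma one_le_sq (x : ℤ) (h : x ≠ 0) : 1 ≤ x ^ 2 := by
  have := sq_pos_of_ne_zero h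
  omega

lemma eq_zero_or_four (x : ℤ) : x = 0 ∨ x = 1 ∨ x = -1 ∨ 4 ≤ x ^ 2 := by
  by_cases h : 2 ≤ x
  · right; right; right; nlinarith
  · by_cases h' : x ≤ -2
    · right; right; right; nlinarith
    · omega

lemma M4_min (x : Fin 5 → ℤ) (hx : x ≠ 0) : 4 ≤ QFval M4 x := by
  rw [M4_val]
  have e1 := sq_nonneg (3 * x 0 - x 3)
  have e2 := sq_nonneg (x 1)
  have e3 := sq_nonneg (3 * x 2 + x 3 - x 4)
  have e4 := sq_nonneg (x 3 + x 4)
  have e5 := sq_nonneg (x 4)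
  by_cases hu : x 3 + x 4 = 0
  · by_cases hw : x 4 = 0
    · have h3 : x 3 = 0 := by omega
      have : x 0 ≠ 0 ∨ x 1 ≠ 0 ∨ x 2 ≠ 0 := by
        by_contra hcon
        push Not at hcon
        apply hx
        funext i
        fin_cases i <;> simp [hcon, hw, h3]
      rw [hw, h3]
      have f0 := sq_nonneg (x 0)
      have f2 := sq_nonneg (x 2)
      rcases this with h | h | h <;> have := one_le_sq _ h <;> nlinarith
    · have a1 := one_le_sq _ hw
      rcases eq_zero_or_four (x 4) with h | h | h | h
      · omega
      · have := one_le_sq (3 * x 0 - x 3) (by omega)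
        have := one_le_sq (3 * x 2 + x 3 - x 4) (by omega)
        linarith
      · have := one_le_sq (3 * x 0 - x 3) (by omega)
        have := one_le_sq (3 * x 2 + x 3 - x 4) (by omega)
        linarith
      · linarith
  · have a1 := one_le_sq _ hu
    by_cases hw : x 4 = 0
    · rcases eq_zero_or_four (x 3 + x 4) with h | h | h | h
      · omega
      · have := one_le_sq (3 * x 0 - x 3) (by omega)
        linarith
      · have := one_le_sq (3 * x 0 - x 3) (by omega)
        linarith
      · linarith
    · have := one_le_sq _ hw
      linarith

lemma M4_rep (m a b c u w : ℤ) (h1 : 3 ∣ b) (h2 : 3 ∣ a - (w - u)) (h3 : 3 ∣ c - (u - 2 * w))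
    (h : a ^ 2 + b ^ 2 + c ^ 2 + 3 * u ^ 2 + 2 * w ^ 2 = m) : QFRep M4 m := by
  obtain ⟨b', rfl⟩ := h1
  obtain ⟨a', ha⟩ := h2
  obtain ⟨c', hc⟩ := h3
  refine ⟨![a', b', c', u - w, w], ?_⟩
  rw [M4_val]
  simp
  rw [← h, show a = 3 * a' + (w - u) by linarith, show c = 3 * c' + (u - 2 * w) by linarith]
  ring

lemma M4_repA (m u w : ℤ) (h0 : 0 ≤ m - (3 * u ^ 2 + 2 * w ^ 2))
    (h1 : (m - (3 * u ^ 2 + 2 * w ^ 2)) % 12 = 2)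
    (h2 : (w - u) % 3 ≠ 0) (h3 : (u - 2 * w) % 3 ≠ 0) : QFRep M4 m := by
  obtain ⟨a, b, c, hb, ha, hc, h⟩ := three_A _ h0 h1 _ _ h2 h3
  exact M4_rep m a b c u w hb ha hc (by linarith)

lemma M4_repB (m u w : ℤ) (h0 : 0 ≤ m - (3 * u ^ 2 + 2 * w ^ 2))
    (h1 : (m - (3 * u ^ 2 + 2 * w ^ 2)) % 12 = 10)
    (h2 : (w - u) % 3 = 0) (h3 : (u - 2 * w) % 3 ≠ 0) : QFRep M4 m := by
  obtain ⟨a, b, c, hb, ha, hc, h⟩ := three_B _ h0 h1 _ h3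
  exact M4_rep m a b c u w hb (by omega) hc (by linarith)

lemma M4_all (m : ℤ) (hm : 4 ≤ m) : QFRep M4 m := by
  have hcl : m % 12 = 0 ∨ m % 12 = 1 ∨ m % 12 = 2 ∨ m % 12 = 3 ∨ m % 12 = 4 ∨ m % 12 = 5 ∨ m % 12 = 6 ∨
    m % 12 = 7 ∨ m % 12 = 8 ∨ m % 12 = 9 ∨ m % 12 = 10 ∨ m % 12 = 11 := by omega
  rcases hcl with h | h | h | h | h | h | h | h | h | h | h | h
  · have h' : m = 12 ∨ 24 ≤ m := by omega
    rcases h' with rfl | h'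
    · exact ⟨![0, 0, -1, 1, -2], by rw [M4_val]; simp⟩
    · exact M4_repB m 2 (-1) (by omega) (by omega) (by omega) (by omega)
  · have h' : m = 13 ∨ m = 25 ∨ 37 ≤ m := by omega
    rcases h' with rfl | rfl | h'
    · exact ⟨![0, -1, -1, 1, -1], by rw [M4_val]; simp⟩
    · exact ⟨![-1, 0, 0, -2, 2], by rw [M4_val]; simp⟩
    · exact M4_repA m 3 2 (by omega) (by omega) (by omega) (by omega)
  · exact M4_repA m 2 0 (by omega) (by omega) (by omega) (by omega)
  · exact M4_repB m 1 1 (by omega) (by omega) (by omega) (by omega)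
  · exact M4_repA m 0 1 (by omega) (by omega) (by omega) (by omega)
  · exact M4_repA m 1 0 (by omega) (by omega) (by omega) (by omega)
  · have h' : m = 6 ∨ m = 18 ∨ 30 ≤ m := by omega
    rcases h' with rfl | rfl | h'
    · exact ⟨![0, 0, 0, 0, -1], by rw [M4_val]; simp⟩
    · exact ⟨![-1, -1, 0, 0, 0], by rw [M4_val]; simp⟩
    · exact M4_repB m 2 2 (by omega) (by omega) (by omega) (by omega)
  · have h' : m = 7 ∨ m = 19 ∨ 31 ≤ m := by omega
    rcases h' with rfl | rfl | h'
    · exact ⟨![0, 0, 0, -1, 1], by rw [M4_val]; simp⟩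
    · exact ⟨![-1, -1, 0, -1, 1], by rw [M4_val]; simp⟩
    · exact M4_repA m 3 1 (by omega) (by omega) (by omega) (by omega)
  · have h' : m = 8 ∨ m = 20 ∨ 32 ≤ m := by omega
    rcases h' with rfl | rfl | h'
    · exact ⟨![-1, 0, 0, -1, 0], by rw [M4_val]; simp⟩
    · exact ⟨![-1, 0, 0, 1, 0], by rw [M4_val]; simp⟩
    · exact M4_repA m 2 3 (by omega) (by omega) (by omega) (by omega)
  · have h' : m = 9 ∨ 21 ≤ m := by omega
    rcases h' with rfl | h'
    · exact ⟨![-1, 0, 0, 0, 0], by rw [M4_val]; simp⟩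
    · exact M4_repB m 1 (-2) (by omega) (by omega) (by omega) (by omega)
  · exact M4_repA m 0 2 (by omega) (by omega) (by omega) (by omega)
  · have h' : m = 11 ∨ 23 ≤ m := by omega
    rcases h' with rfl | h'
    · exact ⟨![-1, 0, 1, -1, 0], by rw [M4_val]; simp⟩
    · exact M4_repA m 1 3 (by omega) (by omega) (by omega) (by omega)

def M5 : Matrix (Fin 6) (Fin 6) ℤ :=
  !![9, 0, 0, 0, 0, 0; 0, 9, 0, 0, 0, 0; 0, 0, 9, 0, -3, 0; 0, 0, 0, 9, 3, 0;
    0, 0, -3, 3, 5, -2; 0, 0, 0, 0, -2, 6]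

lemma M5_val (x : Fin 6 → ℤ) : QFval M5 x = 9 * x 0 ^ 2 + 9 * x 1 ^ 2 + (3 * x 2 - x 4) ^ 2 +
    (3 * x 3 + x 4) ^ 2 + 3 * x 4 ^ 2 - 4 * x 4 * x 5 + 6 * x 5 ^ 2 := by
  simp [QFval, M5, Fin.sum_univ_succ]
  ring

lemma M5_min (x : Fin 6 → ℤ) (hx : x ≠ 0) : 5 ≤ QFval M5 x := by
  rw [M5_val]
  have e0 := sq_nonneg (x 0)
  have e1 := sq_nonneg (x 1)
  have e2 := sq_nonneg (3 * x 2 - x 4)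
  have e3 := sq_nonneg (3 * x 3 + x 4)
  have e4 := sq_nonneg (3 * x 4 - 2 * x 5)
  have e5 := sq_nonneg (x 5)
  by_cases h5 : x 5 = 0
  · rcases eq_zero_or_four (x 4) with h | h | h | h
    · have : x 0 ≠ 0 ∨ x 1 ≠ 0 ∨ x 2 ≠ 0 ∨ x 3 ≠ 0 := by
        by_contra hcon
        push Not at hcon
        apply hx
        funext i
        fin_cases i <;> simp [hcon, h, h5]
      rw [h, h5]
      have f0 := sq_nonneg (x 2)
      have f2 := sq_nonneg (x 3)
      rcases this with h | h | h | h <;> have := one_le_sq _ h <;> nlinarith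
    · have := one_le_sq (3 * x 2 - x 4) (by omega)
      have := one_le_sq (3 * x 3 + x 4) (by omega)
      rw [h5]
      rw [h] at *
      linarith
    · have := one_le_sq (3 * x 2 - x 4) (by omega)
      have := one_le_sq (3 * x 3 + x 4) (by omega)
      rw [h5]
      rw [h] at *
      linarith
    · rw [h5]
      linarith
  · have := one_le_sq _ h5
    have h3 : 14 ≤ 3 * (3 * x 4 ^ 2 - 4 * x 4 * x 5 + 6 * x 5 ^ 2) := by nlinarith
    have h4 : 5 ≤ 3 * x 4 ^ 2 - 4 * x 4 * x 5 + 6 * x 5 ^ 2 := by omega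
    linarith

lemma four_A (N : ℤ) (h0 : 0 ≤ N) (hN : N % 3 = 2) (e f : ℤ) (he : e % 3 ≠ 0) (hf : f % 3 ≠ 0) :
    ∃ a b c d : ℤ, 3 ∣ a ∧ 3 ∣ b ∧ 3 ∣ c - e ∧ 3 ∣ d - f ∧ a ^ 2 + b ^ 2 + c ^ 2 + d ^ 2 = N := by
  lift N to ℕ using h0
  obtain ⟨x, y, z, w, h⟩ := Nat.sum_four_squares N
  have h : (x : ℤ) ^ 2 + (y : ℤ) ^ 2 + (z : ℤ) ^ 2 + (w : ℤ) ^ 2 = N := by exact_mod_cast h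
  generalize (x : ℤ) = x at h
  generalize (y : ℤ) = y at h
  generalize (z : ℤ) = z at h
  generalize (w : ℤ) = w at h
  have key : ∀ x y z w : ℤ, x ^ 2 + y ^ 2 + z ^ 2 + w ^ 2 = N → x % 3 = 0 → y % 3 = 0 →
      z % 3 ≠ 0 → w % 3 ≠ 0 →
      ∃ a b c d : ℤ, 3 ∣ a ∧ 3 ∣ b ∧ 3 ∣ c - e ∧ 3 ∣ d - f ∧
        a ^ 2 + b ^ 2 + c ^ 2 + d ^ 2 = N := by
    intro x y z w h hx hy hz hw
    obtain ⟨a, ha, ha'⟩ := sgn3 z e hz he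
    obtain ⟨c, hc, hc'⟩ := sgn3 w f hw hf
    exact ⟨x, y, a, c, by omega, by omega, ha', hc', by rw [ha, hc, h]⟩
  rcases sq3 x with ⟨h1, h1'⟩ | ⟨h1, h1'⟩ <;> rcases sq3 y with ⟨h2, h2'⟩ | ⟨h2, h2'⟩ <;>
    rcases sq3 z with ⟨h3, h3'⟩ | ⟨h3, h3'⟩ <;> rcases sq3 w with ⟨h4, h4'⟩ | ⟨h4, h4'⟩ <;> first
    | omega
    | exact key x y z w h h1 h2 h3 h4
    | exact key x z y w (by linarith) h1 h3 h2 h4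
    | exact key x w y z (by linarith) h1 h4 h2 h3
    | exact key y z x w (by linarith) h2 h3 h1 h4
    | exact key y w x z (by linarith) h2 h4 h1 h3
    | exact key z w x y (by linarith) h3 h4 h1 h2

lemma M5_repA (m u : ℤ) (h0 : 0 ≤ m - (3 - 4 * u + 6 * u ^ 2))
    (h1 : (m - (3 - 4 * u + 6 * u ^ 2)) % 3 = 2) : QFRep M5 m := by
  obtain ⟨a, b, c, d, ⟨a', rfl⟩, ⟨b', rfl⟩, ⟨c', hc⟩, ⟨d', hd⟩, h⟩ :=
    four_A _ h0 h1 (-1) 1 (by norm_num) (by norm_num)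
  refine ⟨![a', b', c', d', 1, u], ?_⟩
  rw [M5_val]
  simp
  rw [show c = 3 * c' - 1 by linarith, show d = 3 * d' + 1 by linarith] at h
  linarith

lemma M5_all (m : ℤ) (hm : 5 ≤ m) : QFRep M5 m := by
  have : m % 3 = 2 ∨ (m % 3 = 1 ∧ 7 ≤ m) ∨ (m % 3 = 0 ∧ 15 ≤ m) ∨ m = 6 ∨ m = 9 ∨ m = 12 := by omega
  rcases this with h | h | h | h | h | h
  · exact M5_repA m 0 (by omega) (by omega)
  · exact M5_repA m 1 (by omega) (by omega)
  · exact M5_repA m (-1) (by omega) (by omega)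
  · exact ⟨![0, 0, 0, 0, 0, 1], by rw [M5_val, h]; simp⟩
  · exact ⟨![1, 0, 0, 0, 0, 0], by rw [M5_val, h]; simp⟩
  · exact ⟨![0, 0, 1, -1, 2, 1], by rw [M5_val, h]; simp⟩

lemma finish (n : ℕ) (hn : 1 ≤ n) {k : ℕ} (M : Matrix (Fin k) (Fin k) ℤ)
    (hmin : ∀ x, x ≠ 0 → (n : ℤ) ≤ QFval M x) (hall : ∀ m : ℤ, (n : ℤ) ≤ m → QFRep M m) :
    QFPosDef M ∧ QFTight n M := by
  refine ⟨fun x hx => ?_, fun m hm => ⟨?_, hall m⟩⟩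
  · have := hmin x hx
    omega
  · rintro ⟨x, rfl⟩
    apply hmin
    rintro rfl
    apply hm
    simp [QFval]

/-- data of a form in `4 + 3` variables -/
structure Dat where
  (s a0 a1 a2 b0 b1 b2 c0 c1 c2 d0 d1 d2 p q r u v w : ℤ)

namespace Dat

def M (d : Dat) : Matrix (Fin 7) (Fin 7) ℤ :=
  !![d.s, 0, 0, 0, d.a0, d.a1, d.a2;
     0, d.s, 0, 0, d.b0, d.b1, d.b2;
     0, 0, d.s, 0, d.c0, d.c1, d.c2;
     0, 0, 0, d.s, d.d0, d.d1, d.d2;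
     d.a0, d.b0, d.c0, d.d0, d.p, d.w, d.v;
     d.a1, d.b1, d.c1, d.d1, d.w, d.q, d.u;
     d.a2, d.b2, d.c2, d.d2, d.v, d.u, d.r]

def la (d : Dat) (x y z : ℤ) : ℤ := d.a0 * x + d.a1 * y + d.a2 * z
def lb (d : Dat) (x y z : ℤ) : ℤ := d.b0 * x + d.b1 * y + d.b2 * z
def lc (d : Dat) (x y z : ℤ) : ℤ := d.c0 * x + d.c1 * y + d.c2 * z
def ld (d : Dat) (x y z : ℤ) : ℤ := d.d0 * x + d.d1 * y + d.d2 * z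
def Q (d : Dat) (x y z : ℤ) : ℤ :=
  d.p * x ^ 2 + d.q * y ^ 2 + d.r * z ^ 2 + 2 * d.u * y * z + 2 * d.v * x * z + 2 * d.w * x * y

def val (d : Dat) (e f g h x y z : ℤ) : ℤ :=
  d.s * (e ^ 2 + f ^ 2 + g ^ 2 + h ^ 2) +
    2 * (e * d.la x y z + f * d.lb x y z + g * d.lc x y z + h * d.ld x y z) + d.Q x y z

lemma M_symm (d : Dat) : d.M.IsSymm := by
  ext i j
  fin_cases i <;> fin_cases j <;> rfl

lemma M_val (d : Dat) (x : Fin 7 → ℤ) :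
    QFval d.M x = d.val (x 0) (x 1) (x 2) (x 3) (x 4) (x 5) (x 6) := by
  simp [QFval, M, Fin.sum_univ_succ, val, la, lb, lc, ld, Q]
  ring

lemma rep_of_val (d : Dat) (e f g h x y z : ℤ) : QFRep d.M (d.val e f g h x y z) :=
  ⟨![e, f, g, h, x, y, z], by rw [M_val]; rfl⟩

/-- the projected form, scaled by `s` -/
def K (d : Dat) (x y z : ℤ) : ℤ :=
  d.s * d.Q x y z - (d.la x y z ^ 2 + d.lb x y z ^ 2 + d.lc x y z ^ 2 + d.ld x y z ^ 2)

lemma s_val (d : Dat) (e f g h x y z : ℤ) : d.s * d.val e f g h x y z =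
    (d.s * e + d.la x y z) ^ 2 + (d.s * f + d.lb x y z) ^ 2 + (d.s * g + d.lc x y z) ^ 2 +
    (d.s * h + d.ld x y z) ^ 2 + d.K x y z := by
  unfold val K
  ring

def dist (s c : ℤ) : ℤ := if 2 * (c % s) ≤ s then c % s else s - c % s

lemma dist_le (s c t : ℤ) (hs : 0 < s) : dist s c ^ 2 ≤ (s * t + c) ^ 2 := by
  unfold dist
  have h1 := Int.emod_nonneg c hs.ne'
  have h2 := Int.emod_lt_of_pos c hs
  have h3 := Int.emod_add_mul_ediv c s
  have h4 : s * t + c = s * (t + c / s) + c % s := by linear_combination -h3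
  rw [h4]
  generalize t + c / s = k
  generalize c % s = r at *
  have h5 : 0 ≤ (if 2 * r ≤ s then r else s - r) := by split_ifs <;> linarith
  have h6 : (if 2 * r ≤ s then r else s - r) ≤ r := by split_ifs <;> linarith
  have h7 : (if 2 * r ≤ s then r else s - r) ≤ s - r := by split_ifs <;> linarith
  generalize (if 2 * r ≤ s then r else s - r) = D at *
  rcases le_or_gt 0 k with hk | hk
  · have : 0 ≤ s * k := by positivity
    nlinarith
  · have : s * k ≤ -s := by nlinarith
    nlinarith

def ka (d : Dat) : ℤ := d.s * d.p - (d.a0 ^ 2 + d.b0 ^ 2 + d.c0 ^ 2 + d.d0 ^ 2)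
def kb (d : Dat) : ℤ := d.s * d.q - (d.a1 ^ 2 + d.b1 ^ 2 + d.c1 ^ 2 + d.d1 ^ 2)
def kc (d : Dat) : ℤ := d.s * d.r - (d.a2 ^ 2 + d.b2 ^ 2 + d.c2 ^ 2 + d.d2 ^ 2)
def kr (d : Dat) : ℤ := d.s * d.u - (d.a1 * d.a2 + d.b1 * d.b2 + d.c1 * d.c2 + d.d1 * d.d2)
def ks (d : Dat) : ℤ := d.s * d.v - (d.a0 * d.a2 + d.b0 * d.b2 + d.c0 * d.c2 + d.d0 * d.d2)
def kt (d : Dat) : ℤ := d.s * d.w - (d.a0 * d.a1 + d.b0 * d.b1 + d.c0 * d.c1 + d.d0 * d.d1)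
def kdet (d : Dat) : ℤ := d.ka * d.kb * d.kc + 2 * d.kr * d.ks * d.kt - d.ka * d.kr ^ 2 -
  d.kb * d.ks ^ 2 - d.kc * d.kt ^ 2

lemma K_eq (d : Dat) (x y z : ℤ) : d.K x y z = d.ka * x ^ 2 + d.kb * y ^ 2 + d.kc * z ^ 2 +
    2 * d.kr * y * z + 2 * d.ks * x * z + 2 * d.kt * x * y := by
  unfold K Q la lb lc ld ka kb kc kr ks kt
  ring

lemma tern_bound (a b c r s t x y z : ℤ) (ha : 0 < a) (hb : 0 < a * b - t ^ 2) :
    (a * b * c + 2 * r * s * t - a * r ^ 2 - b * s ^ 2 - c * t ^ 2) * z ^ 2 ≤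
    (a * b - t ^ 2) * (a * x ^ 2 + b * y ^ 2 + c * z ^ 2 + 2 * r * y * z + 2 * s * x * z +
      2 * t * x * y) := by
  have h : 0 ≤ (a * b - t ^ 2) * (a * x + t * y + s * z) ^ 2 +
      ((a * b - t ^ 2) * y + (a * r - s * t) * z) ^ 2 := by positivity
  refine le_of_mul_le_mul_left ?_ ha
  linarith

lemma box (D A s n z K : ℤ) (hA : 0 < A) (h : A * (s * n) ≤ D * 16) (hD : 0 < D)
    (hK : D * z ^ 2 ≤ A * K) (hlt : K < s * n) : z ∈ Finset.Icc (-3 : ℤ) 3 := by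
  have h1 : D * z ^ 2 < D * 16 := by nlinarith
  have h2 : z ^ 2 < 16 := lt_of_mul_lt_mul_left h1 hD.le
  rw [Finset.mem_Icc]
  constructor <;> nlinarith

def chkPos (d : Dat) (n : ℤ) : Bool :=
  decide (0 < n ∧ n ≤ d.s ∧ 0 < d.ka ∧ 0 < d.kb ∧ 0 < d.ka * d.kb - d.kt ^ 2 ∧
  0 < d.kb * d.kc - d.kr ^ 2 ∧ 0 < d.ka * d.kc - d.ks ^ 2 ∧ 0 < d.kdet ∧
  (d.ka * d.kb - d.kt ^ 2) * (d.s * n) ≤ d.kdet * 16 ∧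
  (d.kb * d.kc - d.kr ^ 2) * (d.s * n) ≤ d.kdet * 16 ∧
  (d.ka * d.kc - d.ks ^ 2) * (d.s * n) ≤ d.kdet * 16)

noncomputable def chkBox (d : Dat) (n : ℤ) : Bool :=
  decide (∀ x ∈ Finset.Icc (-3 : ℤ) 3, ∀ y ∈ Finset.Icc (-3 : ℤ) 3, ∀ z ∈ Finset.Icc (-3 : ℤ) 3,
    (x = 0 ∧ y = 0 ∧ z = 0) ∨ d.s * n ≤ dist d.s (d.la x y z) ^ 2 + dist d.s (d.lb x y z) ^ 2 +
      dist d.s (d.lc x y z) ^ 2 + dist d.s (d.ld x y z) ^ 2 + d.K x y z)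

lemma M_min (d : Dat) (n : ℤ) (h1 : d.chkPos n = true) (h2 : d.chkBox n = true)
    (x : Fin 7 → ℤ) (hx : x ≠ 0) : n ≤ QFval d.M x := by
  obtain ⟨hn, hns, p1, p2, p3, p4, p5, p6, q3, q4, q5⟩ := of_decide_eq_true h1
  have hbox := of_decide_eq_true h2
  have hs : 0 < d.s := by linarith
  rw [M_val]
  refine le_of_mul_le_mul_left ?_ hs
  by_cases h0 : x 4 = 0 ∧ x 5 = 0 ∧ x 6 = 0
  · obtain ⟨h4, h5, h6⟩ := h0
    rw [h4, h5, h6]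
    have : x 0 ≠ 0 ∨ x 1 ≠ 0 ∨ x 2 ≠ 0 ∨ x 3 ≠ 0 := by
      by_contra hcon
      push Not at hcon
      apply hx
      funext i
      fin_cases i <;> simp [hcon, h4, h5, h6]
    have hv : d.val (x 0) (x 1) (x 2) (x 3) 0 0 0 =
        d.s * (x 0 ^ 2 + x 1 ^ 2 + x 2 ^ 2 + x 3 ^ 2) := by
      simp [val, la, lb, lc, ld, Q]
    rw [hv]
    have e0 := sq_nonneg (x 0)
    have e1 := sq_nonneg (x 1)
    have e2 := sq_nonneg (x 2)
    have e3 := sq_nonneg (x 3)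
    have : 1 ≤ x 0 ^ 2 + x 1 ^ 2 + x 2 ^ 2 + x 3 ^ 2 := by
      rcases this with h | h | h | h <;> have := one_le_sq _ h <;> linarith
    refine mul_le_mul_of_nonneg_left ?_ hs.le
    nlinarith
  · rw [s_val]
    have d0 := dist_le d.s (d.la (x 4) (x 5) (x 6)) (x 0) hs
    have d1 := dist_le d.s (d.lb (x 4) (x 5) (x 6)) (x 1) hs
    have d2 := dist_le d.s (d.lc (x 4) (x 5) (x 6)) (x 2) hs
    have d3 := dist_le d.s (d.ld (x 4) (x 5) (x 6)) (x 3) hs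
    rcases le_or_gt (d.s * n) (d.K (x 4) (x 5) (x 6)) with hK | hK
    · have e0 := sq_nonneg (d.s * x 0 + d.la (x 4) (x 5) (x 6))
      have e1 := sq_nonneg (d.s * x 1 + d.lb (x 4) (x 5) (x 6))
      have e2 := sq_nonneg (d.s * x 2 + d.lc (x 4) (x 5) (x 6))
      have e3 := sq_nonneg (d.s * x 3 + d.ld (x 4) (x 5) (x 6))
      linarith
    · have b6 := tern_bound d.ka d.kb d.kc d.kr d.ks d.kt (x 4) (x 5) (x 6) p1 p3
      have b4 := tern_bound d.kb d.kc d.ka d.ks d.kt d.kr (x 5) (x 6) (x 4) p2 p4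
      have b5 := tern_bound d.ka d.kc d.kb d.kr d.kt d.ks (x 4) (x 6) (x 5) p1 p5
      have k := d.K_eq (x 4) (x 5) (x 6)
      have c6 := box d.kdet _ d.s n (x 6) (d.K (x 4) (x 5) (x 6)) p3 q3 p6
        (by rw [k]; unfold kdet; linarith) hK
      have c5 := box d.kdet _ d.s n (x 5) (d.K (x 4) (x 5) (x 6)) p5 q5 p6
        (by rw [k]; unfold kdet; linarith) hK
      have c4 := box d.kdet _ d.s n (x 4) (d.K (x 4) (x 5) (x 6)) p4 q4 p6
        (by rw [k]; unfold kdet; linarith) hK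
      rcases hbox _ c4 _ c5 _ c6 with h | h
      · exact absurd h h0
      · linarith

/-- `m` is represented thanks to the vector over `(x, y, z)` orthogonal to the four squares. -/
def big (d : Dat) (m : ℤ) (t : ℤ × ℤ × ℤ) : Bool :=
  decide (d.la t.1 t.2.1 t.2.2 % d.s = 0 ∧ d.lb t.1 t.2.1 t.2.2 % d.s = 0 ∧
    d.lc t.1 t.2.1 t.2.2 % d.s = 0 ∧ d.ld t.1 t.2.1 t.2.2 % d.s = 0 ∧
    d.K t.1 t.2.1 t.2.2 ≤ d.s * m ∧ (d.s * m - d.K t.1 t.2.1 t.2.2) % (d.s * d.s) = 0)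

lemma big_rep (d : Dat) (hs : 0 < d.s) (m : ℤ) (t : ℤ × ℤ × ℤ) (h : d.big m t = true) :
    QFRep d.M m := by
  obtain ⟨x, y, z⟩ := t
  obtain ⟨h1, h2, h3, h4, h5, h6⟩ := of_decide_eq_true h
  simp only at h1 h2 h3 h4 h5 h6
  obtain ⟨a, ha⟩ := Int.dvd_of_emod_eq_zero h1
  obtain ⟨b, hb⟩ := Int.dvd_of_emod_eq_zero h2
  obtain ⟨c, hc⟩ := Int.dvd_of_emod_eq_zero h3
  obtain ⟨e, he⟩ := Int.dvd_of_emod_eq_zero h4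
  obtain ⟨N, hN⟩ := Int.dvd_of_emod_eq_zero h6
  have hN0 : 0 ≤ N := by
    by_contra hneg
    push Not at hneg
    have : d.s * d.s * N < 0 := mul_neg_of_pos_of_neg (by positivity) hneg
    linarith
  lift N to ℕ using hN0
  obtain ⟨i, j, k, l, hsum⟩ := Nat.sum_four_squares N
  have hsum : (i : ℤ) ^ 2 + (j : ℤ) ^ 2 + (k : ℤ) ^ 2 + (l : ℤ) ^ 2 = N := by exact_mod_cast hsum
  have hval : d.val (i - a) (j - b) (k - c) (l - e) x y z = m := by
    refine mul_left_cancel₀ hs.ne' ?_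
    rw [s_val, ha, hb, hc, he]
    linear_combination d.s * d.s * hsum - hN
  rw [← hval]
  exact d.rep_of_val _ _ _ _ _ _ _

lemma big_add (d : Dat) (hs : 0 < d.s) (m k : ℤ) (hk : 0 ≤ k) (t : ℤ × ℤ × ℤ)
    (h : d.big m t = true) : d.big (m + d.s * k) t = true := by
  obtain ⟨h1, h2, h3, h4, h5, h6⟩ := of_decide_eq_true h
  refine decide_eq_true ⟨h1, h2, h3, h4, ?_, ?_⟩
  · have : 0 ≤ d.s * (d.s * k) := by positivity
    linarith
  · rw [show d.s * (m + d.s * k) - d.K t.1 t.2.1 t.2.2 =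
      (d.s * m - d.K t.1 t.2.1 t.2.2) + d.s * d.s * k by ring, Int.add_mul_emod_self_left, h6]

abbrev V7 := ℤ × ℤ × ℤ × ℤ × ℤ × ℤ × ℤ

def small (d : Dat) (m : ℤ) (t : V7) : Bool :=
  decide (d.val t.1 t.2.1 t.2.2.1 t.2.2.2.1 t.2.2.2.2.1 t.2.2.2.2.2.1 t.2.2.2.2.2.2 = m)

def chkSmall (d : Dat) (n : ℤ) (T : ℕ) (B : List (ℤ × ℤ × ℤ)) (S : List V7) : Bool :=
  (List.range T).all fun i => B.any (d.big (n + i)) || S.any (d.small (n + i))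

def chkBig (d : Dat) (m : ℤ) (B : List (ℤ × ℤ × ℤ)) : Bool :=
  (List.range d.s.toNat).all fun i => B.any (d.big (m + i))

lemma M_all (d : Dat) (n : ℤ) (T : ℕ) (B : List (ℤ × ℤ × ℤ)) (S : List V7) (hs : 0 < d.s)
    (h1 : d.chkSmall n T B S = true) (h2 : d.chkBig (n + T) B = true) (m : ℤ) (hm : n ≤ m) :
    QFRep d.M m := by
  rcases lt_or_ge m (n + T) with h | h
  · have h3 := List.all_eq_true.1 h1 (m - n).toNat (List.mem_range.2 (by omega))
    rw [Int.toNat_of_nonneg (by omega), show n + (m - n) = m by ring] at h3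
    rw [Bool.or_eq_true] at h3
    rcases h3 with h4 | h4
    · obtain ⟨t, -, ht⟩ := List.any_eq_true.1 h4
      exact d.big_rep hs m t ht
    · obtain ⟨t, -, ht⟩ := List.any_eq_true.1 h4
      rw [← of_decide_eq_true ht]
      exact d.rep_of_val _ _ _ _ _ _ _
  · have e1 := Int.emod_nonneg (m - (n + T)) hs.ne'
    have e2 := Int.emod_lt_of_pos (m - (n + T)) hs
    have e3 := Int.emod_add_mul_ediv (m - (n + T)) d.s
    have h3 := List.all_eq_true.1 h2 ((m - (n + T)) % d.s).toNat (List.mem_range.2 (by omega))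
    rw [Int.toNat_of_nonneg e1] at h3
    obtain ⟨t, -, ht⟩ := List.any_eq_true.1 h3
    have h5 := d.big_add hs _ ((m - (n + T)) / d.s) (Int.ediv_nonneg (by omega) hs.le) t ht
    rw [show n + T + (m - (n + T)) % d.s + d.s * ((m - (n + T)) / d.s) = m by linarith] at h5
    exact d.big_rep hs m t h5

lemma main (n : ℕ) (d : Dat) (T : ℕ) (B : List (ℤ × ℤ × ℤ)) (S : List V7)
    (h1 : d.chkPos n = true) (h2 : d.chkBox n = true)
    (h3 : d.chkSmall n T B S = true) (h4 : d.chkBig (n + T) B = true) :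
    ∃ M : Matrix (Fin 7) (Fin 7) ℤ, M.IsSymm ∧ QFPosDef M ∧ QFTight n M := by
  obtain ⟨hn, hns, -⟩ := of_decide_eq_true h1
  exact ⟨d.M, d.M_symm, finish n (by omega) d.M (d.M_min n h1 h2)
    (d.M_all n T B S (by omega) h3 h4)⟩

end Dat

lemma case6 : ∃ M : Matrix (Fin 7) (Fin 7) ℤ, M.IsSymm ∧ QFPosDef M ∧ QFTight 6 M :=
  Dat.main 6
    ⟨6, 2, -2, -2, -2, 2, 2, 2, -2, -2, -2, 2, 2, 7, 10, 7, 4, 0, -5⟩ 16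
    [(0, 0, 0), (-1, -1, 0), (-1, 0, -1), (0, -1, 1), (-1, -1, 3), (-2, 0, 1)]
    [(0, -1, 1, -1, -1, 0, 1), (0, 0, 0, 0, 0, -1, 0), (-1, 0, -1, 1, 0, -1, 0)]
    (by decide +kernel) (by decide +kernel) (by decide +kernel) (by decide +kernel)

lemma case7 : ∃ M : Matrix (Fin 7) (Fin 7) ℤ, M.IsSymm ∧ QFPosDef M ∧ QFTight 7 M :=
  Dat.main 7
    ⟨7, 0, 0, 0, 0, 0, 0, 0, 0, 0, 0, 0, 0, 11, 9, 8, 0, -3, -5⟩ 6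
    [(0, 0, 0), (0, 0, -1), (0, -1, 0), (-1, -1, 0), (-1, 0, 0), (-1, -1, -1), (-1, 0, -1)]
    []
    (by decide +kernel) (by decide +kernel) (by decide +kernel) (by decide +kernel)

lemma case8 : ∃ M : Matrix (Fin 7) (Fin 7) ℤ, M.IsSymm ∧ QFPosDef M ∧ QFTight 8 M :=
  Dat.main 8
    ⟨8, 0, 0, 0, 0, 0, 0, 0, 0, 0, 0, 0, 0, 11, 9, 12, -3, 5, 3⟩ 7
    [(0, 0, 0), (0, -1, 0), (-1, 1, 1), (-1, 0, 0), (0, 0, -1), (-1, 0, 1), (-1, 1, 0), (0, -1,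
    -1)]
    []
    (by decide +kernel) (by decide +kernel) (by decide +kernel) (by decide +kernel)

lemma case9 : ∃ M : Matrix (Fin 7) (Fin 7) ℤ, M.IsSymm ∧ QFPosDef M ∧ QFTight 9 M :=
  Dat.main 9
    ⟨10, 0, 5, 0, 0, 0, -5, 0, 5, -5, 0, 0, -5, 9, 14, 12, -5, -4, -3⟩ 24
    [(0, 0, 0), (-1, 0, -2), (-2, 0, -2), (-1, -2, 0), (-2, -2, -2), (-1, -2, -2), (-2, -2, -4),
    (-3, -2, -4), (0, 0, -2), (-1, 0, 0)]
    [(0, -1, -1, -1, 0, 0, -1), (0, -1, -1, -1, -1, 0, -1), (-1, -1, -1, -1, -1, 0, -1)]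
    (by decide +kernel) (by decide +kernel) (by decide +kernel) (by decide +kernel)

lemma case10 : ∃ M : Matrix (Fin 7) (Fin 7) ℤ, M.IsSymm ∧ QFPosDef M ∧ QFTight 10 M :=
  Dat.main 10
    ⟨10, 5, 5, 5, 0, 5, 0, -5, 0, 5, -5, 5, 5, 15, 13, 12, 7, -3, 2⟩ 39
    [(0, 0, 0), (-1, 0, -1), (0, -2, 0), (-1, 0, 1), (0, -2, 2), (-1, -2, 1), (-2, 2, 0), (-1,
    2, -1), (0, 0, -2), (-1, -2, -1)]
    [(0, 0, 0, 0, 0, 0, -1), (0, -1, -1, -1, -1, 1, 0), (0, 0, -1, -1, -1, 0, 0), (0, -1, 0, -1,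
    -1, 1, -1), (1, 0, 0, 1, 0, -1, -1), (0, -1, -1, -1, -1, 0, 0), (0, 0, -1, -1, -1, -1, 1),
    (0, 0, 0, 1, 0, -1, -1), (0, 0, 0, 0, 0, -1, -1)]
    (by decide +kernel) (by decide +kernel) (by decide +kernel) (by decide +kernel)

lemma case11 : ∃ M : Matrix (Fin 7) (Fin 7) ℤ, M.IsSymm ∧ QFPosDef M ∧ QFTight 11 M :=
  Dat.main 11
    ⟨12, 0, -4, -4, 0, -4, -4, 0, -4, -4, 0, 4, 4, 15, 11, 13, 2, -7, 4⟩ 87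
    [(0, 0, 0), (-1, 1, -1), (-3, -1, -2), (-1, 0, 0), (-2, 2, -2), (0, -2, -1), (-1, -1, -2),
    (-2, -1, -2), (0, -1, 1), (-2, 0, -3), (-1, -2, -1), (0, -1, -2)]
    [(0, 0, 0, 0, 0, -1, 0), (0, 0, 0, 0, -1, 0, -1), (-1, -1, -1, 0, 0, -1, -1), (-1, -1, 0, 0,
    0, -1, 0), (-1, -1, 0, 0, 0, 0, -1), (-1, -1, 0, 0, -1, 0, -1), (-1, -1, -1, 0, -1, 0, -1),
    (-1, -1, -1, 1, 0, -2, 0), (0, 0, 0, -1, 0, -1, 0), (0, 0, 0, -1, 0, 0, -1), (-1, 0, 0, 0,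
    -1, -1, 0), (-1, 0, 0, 0, 0, -2, 0), (-1, -1, -1, 1, -1, -1, 0), (-1, -1, 0, -1, -1, -1, 0),
    (-2, -1, -1, 0, -1, -1, 0), (-2, 0, 0, -1, -1, -1, 0)]
    (by decide +kernel) (by decide +kernel) (by decide +kernel) (by decide +kernel)

lemma case12 : ∃ M : Matrix (Fin 7) (Fin 7) ℤ, M.IsSymm ∧ QFPosDef M ∧ QFTight 12 M :=
  Dat.main 12
    ⟨12, 0, 4, 4, 0, 0, 0, 0, 4, 4, 0, 4, 4, 12, 15, 16, -2, 7, 0⟩ 89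
    [(0, 0, 0), (-1, 1, -1), (-3, 2, 1), (-2, 1, 2), (-2, 2, 1), (-3, -1, 1), (-1, 2, 1), (-1,
    1, 2), (0, -2, -1), (-1, -1, 1), (-1, -2, -1), (0, -1, 1)]
    [(-1, 0, -1, -1, -1, 1, 1), (0, 0, 0, 0, -1, 0, 1), (0, 0, 0, 0, 0, -1, 0), (0, 0, 0, 0, 0,
    0, -1), (-1, 0, -1, 0, -1, 1, 1), (-1, 0, 0, 0, -1, 0, 1), (0, 0, 0, 1, 0, 0, -1), (-1, 0,
    0, 0, -1, 1, 1), (-1, 0, -1, 0, -1, 0, 1), (0, 0, 1, 1, 0, -1, 0), (-1, -1, -1, -1, -1, 1,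
    1), (-1, 0, -1, -1, -1, 0, 1), (0, -1, 0, 0, 0, 0, -1), (-1, -1, -1, 0, -1, 1, 1), (-1, -1,
    -1, 0, -1, 0, 1), (-2, 0, -1, 0, -1, 1, 1), (-1, -1, -1, -1, -1, 0, 1), (-1, 0, 0, 1, 0, 0,
    -1), (1, 0, 1, 1, -1, -1, -1), (0, 0, 0, 1, -1, 0, -1), (0, 0, 0, 1, -1, -1, -1), (0, 0, 1,
    1, -1, 0, -1), (0, 0, 0, 0, -1, -1, -1), (-1, 0, 0, 0, -1, 0, -1), (0, -1, 0, 0, -1, -1,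
    -1), (-1, -1, 0, 0, -1, 0, -1), (-1, 0, 0, 1, -1, -1, -1), (-1, 0, -1, 1, -1, 0, -1), (-1,
    -1, 0, 1, -1, -1, -1)]
    (by decide +kernel) (by decide +kernel) (by decide +kernel) (by decide +kernel)

lemma case13 : ∃ M : Matrix (Fin 7) (Fin 7) ℤ, M.IsSymm ∧ QFPosDef M ∧ QFTight 13 M :=
  Dat.main 13
    ⟨15, 5, -5, 0, 0, 0, 0, 5, -5, 0, 5, -5, 0, 16, 14, 15, -8, -3, -1⟩ 102
    [(0, 0, 0), (-1, 2, 0), (-1, -4, -2), (-2, 1, 1), (-1, 5, 3), (-1, 2, 1), (-1, -1, -1), (-2,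
    1, 0), (-2, -2, -1), (-1, 2, 2), (-2, -2, -3), (-2, 1, -1), (-1, 2, -1), (-1, -1, 0), (-1,
    -1, -2)]
    [(0, 0, 0, 0, 0, -1, -1), (0, 0, 0, 0, 0, -1, 0), (0, 0, 0, 0, -1, 0, 0), (1, 0, 1, 1, -1,
    1, 0), (-1, 0, 0, 0, 0, -1, -1), (-1, 0, 0, 0, 0, -1, 0), (0, 0, 1, 1, -1, 1, 0), (-1, 0,
    -1, 0, 0, -1, -1), (-1, 0, -1, 0, 0, -1, 0), (0, 0, 0, 0, -1, 0, -1), (0, 0, 1, 1, -1, 0,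
    0), (0, 0, 0, 1, -1, 1, 0), (-1, 0, -1, -1, 0, -1, 0), (0, 0, 0, 0, -1, 1, 0), (-1, -1, 0,
    0, 0, -1, -1), (-1, -1, 0, 0, 0, -1, 0), (-1, -1, -1, 0, 0, -1, -1), (0, -1, 0, 0, -1, 0,
    -1), (-1, 0, 0, 0, -1, 0, 0), (0, 0, 0, 1, -1, 0, 1), (0, 0, 1, 1, -1, 0, 1), (-1, 0, -1, 1,
    0, -1, 0), (-2, 0, 0, 0, 0, -1, -1), (-1, 0, 0, 1, -1, 0, -1), (0, -1, 0, 1, -1, 0, 1), (-1,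
    0, 0, 0, -1, 0, 1), (-2, 0, -1, -1, 0, -1, 0), (-2, -1, 0, 0, 0, -1, -1), (-1, -1, 0, 1, -1,
    0, -1), (-1, -1, 0, 0, -1, 0, 1), (-2, -1, -1, -1, 0, -1, 0), (0, -2, 0, 0, -1, 0, -1), (-1,
    0, -1, 1, -1, 0, 1), (-2, -1, 0, 1, 0, -1, 0), (-1, 0, -1, -1, -1, 0, -1)]
    (by decide +kernel) (by decide +kernel) (by decide +kernel) (by decide +kernel)

lemma case14 : ∃ M : Matrix (Fin 7) (Fin 7) ℤ, M.IsSymm ∧ QFPosDef M ∧ QFTight 14 M :=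
  Dat.main 14
    ⟨15, 5, -5, 0, -5, 5, 0, -5, 5, 0, -5, 5, 0, 18, 17, 15, 8, -9, -9⟩ 132
    [(0, 0, 0), (-4, -1, -2), (-1, -1, 0), (-3, 0, -1), (-1, -1, 1), (-2, 1, 0), (-2, 1, -2),
    (-1, 2, -2), (-2, -2, 0), (-3, 0, -2), (-4, 2, -5), (-1, -1, -3), (-1, 2, -1), (-2, 1, -1),
    (-2, 1, -3)]
    [(1, -1, -1, -1, -1, 1, -1), (0, 0, 0, 0, 0, -1, 1), (0, 0, 0, 0, -1, 0, 0), (0, -1, -1, -1,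
    -1, 1, -1), (0, -1, 0, 0, -1, 0, -1), (0, -1, 0, 0, -1, 0, 0), (0, -1, -1, 0, -1, 1, -1),
    (0, -1, -1, 0, -1, 0, -1), (-1, 0, 0, 1, 0, -1, 1), (0, -1, 0, 0, -1, 1, -1), (-1, 0, 1, 1,
    0, -1, 1), (0, -1, -1, -1, -1, 0, 0), (1, -1, -1, -1, -1, 0, -1), (1, -1, -1, -1, -1, 0, 0),
    (1, -2, -1, -1, -1, 1, -1), (-1, 0, 0, 0, -1, 0, -1), (0, -1, 0, 0, 0, -1, 1), (-1, -1, 0,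
    0, 0, -1, 1), (-1, -1, 0, 0, -1, 0, 0), (-1, -1, -1, 0, -1, 0, -1), (-1, -1, -1, 0, -1, 0,
    0), (-1, -1, -1, -1, -1, 0, -1), (0, -1, 0, 0, -1, 0, 1), (0, -1, -1, 0, -1, 0, 1), (-1, -1,
    0, 1, -1, 0, -1), (1, -1, -1, -1, -1, 0, 1), (-1, 0, 0, 0, -1, 0, 1), (-1, -2, -1, 0, -1, 0,
    -1), (-1, -1, -1, 0, -1, 0, 1), (-1, -1, -1, -1, -1, 0, 1), (-2, -1, 0, 0, -1, 0, -1), (-1,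
    0, 0, 1, -1, 0, 1), (-1, -1, 0, 1, -1, 0, 1), (-1, -2, 0, 0, -1, 0, 1), (-2, 0, 0, 0, -1, 0,
    1)]
    (by decide +kernel) (by decide +kernel) (by decide +kernel) (by decide +kernel)

/-- For `4 ≤ n ≤ 14`: `t(n) ≤ n + 1` if `4 ≤ n ≤ 6`, and `t(n) ≤ 7` if `7 ≤ n ≤ 14`. -/
theorem stmt_14 (n : ℕ) (h₁ : 4 ≤ n) (h₂ : n ≤ 14) :
    (n ≤ 6 → ∃ k ≤ n + 1, ∃ M : Matrix (Fin k) (Fin k) ℤ,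
      M.IsSymm ∧ QFPosDef M ∧ QFTight n M) ∧
    (7 ≤ n → ∃ k ≤ 7, ∃ M : Matrix (Fin k) (Fin k) ℤ,
      M.IsSymm ∧ QFPosDef M ∧ QFTight n M) := by
  constructor
  · intro h
    have hc : n = 4 ∨ n = 5 ∨ n = 6 := by omega
    rcases hc with rfl | rfl | rfl
    · refine ⟨5, by norm_num, M4, ?_, finish 4 (by norm_num) M4 M4_min M4_all⟩
      ext i j
      fin_cases i <;> fin_cases j <;> rfl
    · refine ⟨6, by norm_num, M5, ?_, finish 5 (by norm_num) M5 M5_min M5_all⟩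
      ext i j
      fin_cases i <;> fin_cases j <;> rfl
    · exact ⟨7, by norm_num, case6⟩
  · intro h
    refine ⟨7, le_refl 7, ?_⟩
    have hc : n = 7 ∨ n = 8 ∨ n = 9 ∨ n = 10 ∨ n = 11 ∨ n = 12 ∨ n = 13 ∨ n = 14 := by omega
    rcases hc with rfl | rfl | rfl | rfl | rfl | rfl | rfl | rfl
    · exact case7
    · exact case8
    · exact case9
    · exact case10
    · exact case11
    · exact case12
    · exact case13
    · exact case14
end

section
/- For any integer n with 15 ≤ n ≤ 21, t(n) ≤ 8. -/
/-- Hurwitz norm form. -/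
def hN (a b c e : ℤ) : ℤ := a*a+b*b+c*c+e*e+e*(a+b+c)

/-- first block -/
def hA (p : Fin 10 → ℤ) (a b c e : ℤ) : ℤ :=
  p 0*a*a+p 1*b*b+p 2*c*c+p 3*e*e
    +2*(p 4*a*b+p 5*a*c+p 6*a*e+p 7*b*c+p 8*b*e+p 9*c*e)

def hG (d : ℤ) (p : Fin 10 → ℤ) (a b c e : ℤ) : ℤ := hA p a b c e - d * hN a b c e

/-- minimal norm in a class mod 2 -/
def hlow (a b c e : ℤ) : ℤ :=
  if hN a b c e % 2 = 1 then 1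
  else if a % 2 = 0 ∧ b % 2 = 0 ∧ c % 2 = 0 ∧ e % 2 = 0 then 0 else 2

def hstep (a b c e : ℤ) : ℤ := if hN a b c e % 2 = 1 then 2 else 4

def hM (d : ℤ) (p : Fin 10 → ℤ) : Matrix (Fin 8) (Fin 8) ℤ :=
  !![p 0, p 4, p 5, p 6, 2*d, 0, 0, d;
     p 4, p 1, p 7, p 8, 0, 2*d, 0, d;
     p 5, p 7, p 2, p 9, 0, 0, 2*d, d;
     p 6, p 8, p 9, p 3, d, d, d, 2*d;
     2*d, 0, 0, d, 4*d, 0, 0, 2*d;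
     0, 2*d, 0, d, 0, 4*d, 0, 2*d;
     0, 0, 2*d, d, 0, 0, 4*d, 2*d;
     d, d, d, 2*d, 2*d, 2*d, 2*d, 4*d]

lemma hM_symm (d : ℤ) (p : Fin 10 → ℤ) : (hM d p).IsSymm := by
  ext i j
  fin_cases i <;> fin_cases j <;> rfl

lemma hM_val (d : ℤ) (p : Fin 10 → ℤ) (x : Fin 8 → ℤ) :
    QFval (hM d p) x = hG d p (x 0) (x 1) (x 2) (x 3)
      + d * hN (x 0 + 2 * x 4) (x 1 + 2 * x 5) (x 2 + 2 * x 6) (x 3 + 2 * x 7) := by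
  simp only [QFval, hM, hG, hA, hN, Fin.sum_univ_eight]
  simp [Matrix.of_apply, Matrix.cons_val]
  ring

lemma hN_four (a b c e : ℤ) :
    4 * hN a b c e = (2*a+e)^2+(2*b+e)^2+(2*c+e)^2+e^2 := by
  unfold hN; ring

lemma hN_nonneg (a b c e : ℤ) : 0 ≤ hN a b c e := by
  have := hN_four a b c e
  have h : 0 ≤ (2*a+e)^2+(2*b+e)^2+(2*c+e)^2+e^2 := by positivity
  omega

lemma hN_zero {a b c e : ℤ} (h : hN a b c e = 0) : a = 0 ∧ b = 0 ∧ c = 0 ∧ e = 0 := by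
  have h4 := hN_four a b c e
  rw [h] at h4
  have he : e = 0 := by
    have : e^2 ≤ 0 := by nlinarith [sq_nonneg (2*a+e), sq_nonneg (2*b+e), sq_nonneg (2*c+e)]
    exact pow_eq_zero_iff (two_ne_zero) |>.1 (le_antisymm this (sq_nonneg e))
  subst he
  have ha : a^2 ≤ 0 := by nlinarith [sq_nonneg a, sq_nonneg b, sq_nonneg c]
  have hb : b^2 ≤ 0 := by nlinarith [sq_nonneg a, sq_nonneg b, sq_nonneg c]
  have hc : c^2 ≤ 0 := by nlinarith [sq_nonneg a, sq_nonneg b, sq_nonneg c]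
  exact ⟨pow_eq_zero_iff (two_ne_zero) |>.1 (le_antisymm ha (sq_nonneg a)),
    pow_eq_zero_iff (two_ne_zero) |>.1 (le_antisymm hb (sq_nonneg b)),
    pow_eq_zero_iff (two_ne_zero) |>.1 (le_antisymm hc (sq_nonneg c)), rfl⟩

lemma hN_shift (a b c e a' b' c' e' : ℤ) :
    hN (a+2*a') (b+2*b') (c+2*c') (e+2*e') = hN a b c e +
      2 * (2*(a*a'+b*b'+c*c'+e*e') + e*(a'+b'+c')+e'*(a+b+c)) + 4 * hN a' b' c' e' := by
  unfold hN; ring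

lemma hlow_le (a b c e a' b' c' e' : ℤ) :
    hlow a b c e ≤ hN (a+2*a') (b+2*b') (c+2*c') (e+2*e') := by
  have h0 := hN_nonneg (a+2*a') (b+2*b') (c+2*c') (e+2*e')
  have hs := hN_shift a b c e a' b' c' e'
  unfold hlow
  split_ifs with h1 h2
  · omega
  · exact h0
  · by_contra hlt
    have hz : hN (a+2*a') (b+2*b') (c+2*c') (e+2*e') = 0 := by omega
    have := hN_zero hz
    omega

/-- Hurwitz multiplication, basis 1, i, j, ω. -/
def m0 (a b c e a' b' c' e' : ℤ) : ℤ := a*a' - b*b' - c*c' - b*c' + c*b' - b*e' - e*c' - e*e'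
def m1 (a b c e a' b' c' e' : ℤ) : ℤ := a*b' + b*a' - b*c' + c*b' + c*e' + e*b' - e*c'
def m2 (a b c e a' b' c' e' : ℤ) : ℤ := a*c' + c*a' - b*c' + c*b' - b*e' + c*e' + e*b'
def m3 (a b c e a' b' c' e' : ℤ) : ℤ :=
  a*e' + e*a' + 2*b*c' - 2*c*b' + b*e' - c*e' - e*b' + e*c' + e*e'

lemma hN_mul (a b c e a' b' c' e' : ℤ) :
    hN (m0 a b c e a' b' c' e') (m1 a b c e a' b' c' e') (m2 a b c e a' b' c' e')
      (m3 a b c e a' b' c' e') = hN a b c e * hN a' b' c' e' := by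
  unfold hN m0 m1 m2 m3; ring

lemma hN_univ (m : ℕ) : ∃ a b c e : ℤ, hN a b c e = m := by
  obtain ⟨p, q, r, s, h⟩ := Nat.sum_four_squares m
  refine ⟨p - s, q - s, r - s, 2 * s, ?_⟩
  rw [← h]; unfold hN; push_cast; ring

def uC (z0 z1 z2 z3 w0 w1 w2 w3 u0 u1 u2 u3 : ℤ) : Prop :=
  hN u0 u1 u2 u3 = 1 ∧ (m0 u0 u1 u2 u3 z0 z1 z2 z3 - w0) % 2 = 0 ∧
    (m1 u0 u1 u2 u3 z0 z1 z2 z3 - w1) % 2 = 0 ∧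
    (m2 u0 u1 u2 u3 z0 z1 z2 z3 - w2) % 2 = 0 ∧
    (m3 u0 u1 u2 u3 z0 z1 z2 z3 - w3) % 2 = 0

instance (z0 z1 z2 z3 w0 w1 w2 w3 u0 u1 u2 u3 : ℤ) :
    Decidable (uC z0 z1 z2 z3 w0 w1 w2 w3 u0 u1 u2 u3) := by unfold uC; infer_instance

lemma units_trans : ∀ z0 ∈ Finset.Icc (0:ℤ) 1, ∀ z1 ∈ Finset.Icc (0:ℤ) 1,
    ∀ z2 ∈ Finset.Icc (0:ℤ) 1, ∀ z3 ∈ Finset.Icc (0:ℤ) 1,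
    ∀ w0 ∈ Finset.Icc (0:ℤ) 1, ∀ w1 ∈ Finset.Icc (0:ℤ) 1,
    ∀ w2 ∈ Finset.Icc (0:ℤ) 1, ∀ w3 ∈ Finset.Icc (0:ℤ) 1,
    hlow z0 z1 z2 z3 = hlow w0 w1 w2 w3 →
    ∃ u0 ∈ Finset.Icc (-1:ℤ) 1, ∃ u1 ∈ Finset.Icc (-1:ℤ) 1,
    ∃ u2 ∈ Finset.Icc (-1:ℤ) 1, ∃ u3 ∈ Finset.Icc (-1:ℤ) 2,
      uC z0 z1 z2 z3 w0 w1 w2 w3 u0 u1 u2 u3 := by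
  decide +kernel

lemma hN_mod (a b c e : ℤ) : hN a b c e % 2 = hN (a%2) (b%2) (c%2) (e%2) % 2 := by
  have h := hN_shift (a%2) (b%2) (c%2) (e%2) (a/2) (b/2) (c/2) (e/2)
  rw [Int.emod_add_mul_ediv, Int.emod_add_mul_ediv, Int.emod_add_mul_ediv,
    Int.emod_add_mul_ediv] at h
  omega

lemma hlow_mod (a b c e : ℤ) : hlow a b c e = hlow (a%2) (b%2) (c%2) (e%2) := by
  unfold hlow
  rw [hN_mod a b c e]
  simp

lemma class_move (z0 z1 z2 z3 w0 w1 w2 w3 : ℤ)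
    (h : hlow z0 z1 z2 z3 = hlow w0 w1 w2 w3) :
    ∃ y0 y1 y2 y3 : ℤ,
      hN (w0+2*y0) (w1+2*y1) (w2+2*y2) (w3+2*y3) = hN z0 z1 z2 z3 := by
  rw [hlow_mod z0, hlow_mod w0] at h
  have key : ∀ t : ℤ, t % 2 ∈ Finset.Icc (0:ℤ) 1 := by
    intro t; rw [Finset.mem_Icc]; omega
  obtain ⟨u0, -, u1, -, u2, -, u3, -, hu⟩ := units_trans _ (key z0) _ (key z1) _ (key z2)
    _ (key z3) _ (key w0) _ (key w1) _ (key w2) _ (key w3) h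
  obtain ⟨hu, e0, e1, e2, e3⟩ := hu
  have dv : ∀ t s r : ℤ, (r - s % 2) % 2 = 0 → t % 2 = r % 2 → ∃ y, t = s + 2 * y := by
    intro t s r h1 h2
    exact ⟨(t - s)/2, by omega⟩
  have hz : ∀ t : ℤ, t % 2 + 2 * (t / 2) = t := fun t => by omega
  have aux : ∀ r t y : ℤ, t = r + 2 * y → t % 2 = r % 2 := by intro r t y h; omega
  obtain ⟨y0, h0⟩ := dv (m0 u0 u1 u2 u3 z0 z1 z2 z3) w0 _ e0 (by
    refine aux _ _ (m0 u0 u1 u2 u3 (z0/2) (z1/2) (z2/2) (z3/2)) ?_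
    conv_lhs => rw [← hz z0, ← hz z1, ← hz z2, ← hz z3]
    unfold m0; ring)
  obtain ⟨y1, h1⟩ := dv (m1 u0 u1 u2 u3 z0 z1 z2 z3) w1 _ e1 (by
    refine aux _ _ (m1 u0 u1 u2 u3 (z0/2) (z1/2) (z2/2) (z3/2)) ?_
    conv_lhs => rw [← hz z0, ← hz z1, ← hz z2, ← hz z3]
    unfold m1; ring)
  obtain ⟨y2, h2⟩ := dv (m2 u0 u1 u2 u3 z0 z1 z2 z3) w2 _ e2 (by
    refine aux _ _ (m2 u0 u1 u2 u3 (z0/2) (z1/2) (z2/2) (z3/2)) ?_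
    conv_lhs => rw [← hz z0, ← hz z1, ← hz z2, ← hz z3]
    unfold m2; ring)
  obtain ⟨y3, h3⟩ := dv (m3 u0 u1 u2 u3 z0 z1 z2 z3) w3 _ e3 (by
    refine aux _ _ (m3 u0 u1 u2 u3 (z0/2) (z1/2) (z2/2) (z3/2)) ?_
    conv_lhs => rw [← hz z0, ← hz z1, ← hz z2, ← hz z3]
    unfold m3; ring)
  refine ⟨y0, y1, y2, y3, ?_⟩
  rw [← h0, ← h1, ← h2, ← h3, hN_mul, hu, one_mul]

lemma class_rep (w0 w1 w2 w3 : ℤ) (k : ℕ) :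
    ∃ y0 y1 y2 y3 : ℤ, hN (w0+2*y0) (w1+2*y1) (w2+2*y2) (w3+2*y3)
      = hlow w0 w1 w2 w3 + hstep w0 w1 w2 w3 * k := by
  by_cases h1 : hN w0 w1 w2 w3 % 2 = 1
  · obtain ⟨a, b, c, e, h⟩ := hN_univ (1 + 2 * k)
    push_cast at h
    have hl : hlow w0 w1 w2 w3 = 1 := by simp [hlow, h1]
    have hs : hstep w0 w1 w2 w3 = 2 := by simp [hstep, h1]
    have hl' : hlow a b c e = 1 := by
      have : hN a b c e % 2 = 1 := by omega
      simp [hlow, this]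
    rw [hl, hs, ← h]
    exact class_move _ _ _ _ _ _ _ _ (hl'.trans hl.symm)
  · by_cases h2 : w0 % 2 = 0 ∧ w1 % 2 = 0 ∧ w2 % 2 = 0 ∧ w3 % 2 = 0
    · obtain ⟨a, b, c, e, h⟩ := hN_univ k
      refine ⟨a - w0/2, b - w1/2, c - w2/2, e - w3/2, ?_⟩
      have hl : hlow w0 w1 w2 w3 = 0 := by simp only [hlow, if_neg h1, if_pos h2]
      have hs : hstep w0 w1 w2 w3 = 4 := by simp only [hstep, if_neg h1]
      rw [hl, hs, ← h]
      have e0 : w0 + 2 * (a - w0/2) = 2 * a := by omega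
      have e1 : w1 + 2 * (b - w1/2) = 2 * b := by omega
      have e2 : w2 + 2 * (c - w2/2) = 2 * c := by omega
      have e3 : w3 + 2 * (e - w3/2) = 2 * e := by omega
      rw [e0, e1, e2, e3]; unfold hN; ring
    · obtain ⟨a, b, c, e, h⟩ := hN_univ (2 + 4 * k)
      push_cast at h
      have hl : hlow w0 w1 w2 w3 = 2 := by simp only [hlow, if_neg h1, if_neg h2]
      have hs : hstep w0 w1 w2 w3 = 4 := by simp only [hstep, if_neg h1]
      have hl' : hlow a b c e = 2 := by
        have h3 : ¬ hN a b c e % 2 = 1 := by omega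
        have h4 : ¬ (a % 2 = 0 ∧ b % 2 = 0 ∧ c % 2 = 0 ∧ e % 2 = 0) := by
          rintro ⟨q0, q1, q2, q3⟩
          have hsh := hN_shift 0 0 0 0 (a/2) (b/2) (c/2) (e/2)
          have e0 : 0 + 2 * (a/2) = a := by omega
          have e1 : 0 + 2 * (b/2) = b := by omega
          have e2 : 0 + 2 * (c/2) = c := by omega
          have e3 : 0 + 2 * (e/2) = e := by omega
          rw [e0, e1, e2, e3] at hsh
          have : hN 0 0 0 0 = 0 := by decide
          simp only [zero_mul, mul_zero, add_zero, this, zero_add] at hsh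
          omega
        simp only [hlow, if_neg h3, if_neg h4]
      rw [hl, hs, ← h]
      exact class_move _ _ _ _ _ _ _ _ (hl'.trans hl.symm)

lemma main_red (n : ℕ) (d : ℤ) (p : Fin 10 → ℤ) (L : List (ℤ × ℤ × ℤ × ℤ))
    (hn : 0 < n) (hd : 0 < d) (hnd : (n:ℤ) ≤ 4 * d)
    (hb : ∀ a b c e : ℤ, hG d p a b c e < n → a^2 < 9 ∧ b^2 < 9 ∧ c^2 < 9 ∧ e^2 < 9)
    (hbox : ∀ a ∈ Finset.Icc (-2:ℤ) 2, ∀ b ∈ Finset.Icc (-2:ℤ) 2,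
      ∀ c ∈ Finset.Icc (-2:ℤ) 2, ∀ e ∈ Finset.Icc (-2:ℤ) 2,
      (a = 0 ∧ b = 0 ∧ c = 0 ∧ e = 0) ∨ (n:ℤ) ≤ hG d p a b c e + d * hlow a b c e)
    (hrep : ∀ r ∈ Finset.Ico (n:ℤ) (n + 4 * d), ∃ w ∈ L,
      hG d p w.1 w.2.1 w.2.2.1 w.2.2.2 + d * hlow w.1 w.2.1 w.2.2.1 w.2.2.2 ≤ r ∧
      (r - (hG d p w.1 w.2.1 w.2.2.1 w.2.2.2 + d * hlow w.1 w.2.1 w.2.2.1 w.2.2.2))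
        % (d * hstep w.1 w.2.1 w.2.2.1 w.2.2.2) = 0) :
    ∃ k ≤ 8, ∃ M : Matrix (Fin k) (Fin k) ℤ,
      M.IsSymm ∧ QFPosDef M ∧ QFTight n M := by
  have hlow0 : ∀ a b c e : ℤ, 0 ≤ hlow a b c e := by
    intro a b c e; unfold hlow; split_ifs <;> norm_num
  have hmin : ∀ x : Fin 8 → ℤ, x ≠ 0 → (n:ℤ) ≤ QFval (hM d p) x := by
    intro x hx
    rw [hM_val]
    have hl := hlow_le (x 0) (x 1) (x 2) (x 3) (x 4) (x 5) (x 6) (x 7)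
    have hl2 := mul_le_mul_of_nonneg_left hl hd.le
    have hl3 := mul_nonneg hd.le (hlow0 (x 0) (x 1) (x 2) (x 3))
    by_cases hg : hG d p (x 0) (x 1) (x 2) (x 3) < n
    · obtain ⟨b0, b1, b2, b3⟩ := hb _ _ _ _ hg
      have key : ∀ t : ℤ, t^2 < 9 → t ∈ Finset.Icc (-2:ℤ) 2 := by
        intro t ht
        rw [Finset.mem_Icc]; constructor <;> nlinarith
      rcases hbox _ (key _ b0) _ (key _ b1) _ (key _ b2) _ (key _ b3) with h | h
      · obtain ⟨q0, q1, q2, q3⟩ := h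
        have hG0 : hG d p 0 0 0 0 = 0 := by simp [hG, hA, hN]
        have hN4 : hN (0+2*x 4) (0+2*x 5) (0+2*x 6) (0+2*x 7)
            = 4 * hN (x 4) (x 5) (x 6) (x 7) := by unfold hN; ring
        rw [q0, q1, q2, q3, hG0, hN4]
        have hp : 1 ≤ hN (x 4) (x 5) (x 6) (x 7) := by
          by_contra hlt
          have h0 := hN_nonneg (x 4) (x 5) (x 6) (x 7)
          obtain ⟨r0, r1, r2, r3⟩ := hN_zero (show hN (x 4) (x 5) (x 6) (x 7) = 0 by omega)
          apply hx
          ext i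
          fin_cases i <;> simpa
        nlinarith
      · linarith
    · linarith
  refine ⟨8, le_rfl, hM d p, hM_symm d p, ?_, ?_⟩
  · intro x hx
    have := hmin x hx
    omega
  · intro m hm
    constructor
    · rintro ⟨x, rfl⟩
      apply hmin
      rintro rfl
      apply hm
      simp [QFval]
    · intro hnm
      have h4 : 0 < 4 * d := by linarith
      have r1 := Int.emod_nonneg (m - n) h4.ne'
      have r2 := Int.emod_lt_of_pos (m - n) h4
      have r3 := Int.emod_add_mul_ediv (m - n) (4 * d)
      have t0 : 0 ≤ (m - n) / (4 * d) := Int.ediv_nonneg (by omega) h4.le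
      set ρ := (m - n) % (4 * d)
      set t := (m - n) / (4 * d)
      obtain ⟨⟨a, b, c, e⟩, -, hle, hmod⟩ := hrep (n + ρ) (by
        rw [Finset.mem_Ico]; constructor <;> linarith)
      simp only at hle hmod
      obtain ⟨s, hs⟩ := Int.dvd_of_emod_eq_zero hmod
      have hst : 0 < d * hstep a b c e ∧ ∃ q : ℤ, 0 ≤ q ∧ 4 = hstep a b c e * q := by
        unfold hstep; split_ifs
        · exact ⟨by linarith, 2, by norm_num⟩
        · exact ⟨by linarith, 1, by norm_num⟩
      obtain ⟨hst, q, hq0, hq⟩ := hst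
      have s0 : 0 ≤ s := by
        by_contra hneg
        push Not at hneg
        have := mul_neg_of_pos_of_neg hst hneg
        linarith
      have hk0 : 0 ≤ s + q * t := by positivity
      obtain ⟨k, hk⟩ := Int.eq_ofNat_of_zero_le hk0
      obtain ⟨y0, y1, y2, y3, hy⟩ := class_rep a b c e k
      refine ⟨![a, b, c, e, y0, y1, y2, y3], ?_⟩
      rw [hM_val]
      change hG d p a b c e + d * hN (a+2*y0) (b+2*y1) (c+2*y2) (e+2*y3) = m
      rw [hy, show (k:ℤ) = s + q * t from hk.symm]
      have : m = n + ρ + d * (hstep a b c e * q) * t := by rw [← hq]; linarith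
      rw [this]
      linear_combination -hs

lemma case_15 : ∃ k ≤ 8, ∃ M : Matrix (Fin k) (Fin k) ℤ,
    M.IsSymm ∧ QFPosDef M ∧ QFTight 15 M := by
  refine main_red 15 4 ![17, 19, 22, 20, 6, 3, 4, 8, 3, -8]
    [(0, -1, 1, 1), (0, 0, 0, 0), (1, 0, 0, 0), (0, 0, 1, 1), (0, 1, 0, 0), (0, 0, 0, 1), (-1, 0, 1, 1), (0, 0, 1, 0), (-1, 1, 0, 0)]
    (by norm_num) (by norm_num) (by norm_num) ?_ (by decide +kernel) (by decide +kernel)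
  intro a b c e h
  have h' : (13)*(a*a) + (15)*(b*b) + (18)*(c*c) + (16)*(e*e) + (12)*(a*b) + (6)*(a*c) + (4)*(a*e) + (16)*(b*c) + (2)*(b*e) + (-20)*(c*e) < 15 := by
    refine lt_of_eq_of_lt ?_ h
    simp [hG, hA, hN, Matrix.cons_val]
    ring
  refine ⟨?_, ?_, ?_, ?_⟩
  · linarith [sq_nonneg ((6)*a + (15)*b + (8)*c + (1)*e), sq_nonneg ((-3)*a + (206)*c + (-158)*e), sq_nonneg ((149)*a + (809)*e)]
  · linarith [sq_nonneg ((13)*a + (6)*b + (3)*c + (2)*e), sq_nonneg ((86)*b + (225)*c + (-136)*e), sq_nonneg ((917)*b + (2108)*e)]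
  · linarith [sq_nonneg ((13)*a + (6)*b + (3)*c + (2)*e), sq_nonneg ((159)*b + (86)*c + (1)*e), sq_nonneg ((-334)*c + (499)*e)]
  · linarith [sq_nonneg ((13)*a + (6)*b + (3)*c + (2)*e), sq_nonneg ((159)*b + (86)*c + (1)*e), sq_nonneg ((2183)*c + (-1670)*e)]

lemma case_16 : ∃ k ≤ 8, ∃ M : Matrix (Fin k) (Fin k) ℤ,
    M.IsSymm ∧ QFPosDef M ∧ QFTight 16 M := by
  refine main_red 16 4 ![17, 19, 17, 26, -8, -3, -7, 6, 3, -3]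
    [(0, 0, 0, 0), (0, 0, 1, 0), (1, 0, 1, 1), (0, 1, 0, 0), (1, 1, 0, 0), (1, 0, 0, 1), (1, 1, 0, 1), (-1, -1, 1, 0), (0, -1, 1, 0), (1, 0, 1, 0)]
    (by norm_num) (by norm_num) (by norm_num) ?_ (by decide +kernel) (by decide +kernel)
  intro a b c e h
  have h' : (13)*(a*a) + (15)*(b*b) + (13)*(c*c) + (22)*(e*e) + (-16)*(a*b) + (-6)*(a*c) + (-18)*(a*e) + (12)*(b*c) + (2)*(b*e) + (-10)*(c*e) < 16 := by
    refine lt_of_eq_of_lt ?_ h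
    simp [hG, hA, hN, Matrix.cons_val]
    ring
  refine ⟨?_, ?_, ?_, ?_⟩
  · linarith [sq_nonneg ((-8)*a + (15)*b + (6)*c + (1)*e), sq_nonneg ((1)*a + (53)*c + (-27)*e), sq_nonneg ((-133)*a + (305)*e)]
  · linarith [sq_nonneg ((13)*a + (-8)*b + (-3)*c + (-9)*e), sq_nonneg ((27)*b + (80)*c + (-46)*e), sq_nonneg ((-43)*b + (234)*e)]
  · linarith [sq_nonneg ((13)*a + (-8)*b + (-3)*c + (-9)*e), sq_nonneg ((131)*b + (54)*c + (-59)*e), sq_nonneg ((-11)*c + (29)*e)]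
  · linarith [sq_nonneg ((13)*a + (-8)*b + (-3)*c + (-9)*e), sq_nonneg ((131)*b + (54)*c + (-59)*e), sq_nonneg ((694)*c + (-341)*e)]

lemma case_17 : ∃ k ≤ 8, ∃ M : Matrix (Fin k) (Fin k) ℤ,
    M.IsSymm ∧ QFPosDef M ∧ QFTight 17 M := by
  refine main_red 17 5 ![20, 26, 17, 21, -14, -8, 9, 8, 1, -2]
    [(0, 0, 1, 0), (1, 1, 0, 0), (-1, -1, 0, 1), (0, 0, 0, 0), (0, 0, 0, 1), (-1, -1, 1, 1), (-1, 0, 0, 1), (0, 0, 1, 1), (1, 1, 1, 0), (0, 1, 0, 0), (-1, 0, -1, 1), (1, 0, 0, 0)]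
    (by norm_num) (by norm_num) (by norm_num) ?_ (by decide +kernel) (by decide +kernel)
  intro a b c e h
  have h' : (15)*(a*a) + (21)*(b*b) + (12)*(c*c) + (16)*(e*e) + (-28)*(a*b) + (-16)*(a*c) + (13)*(a*e) + (16)*(b*c) + (-3)*(b*e) + (-9)*(c*e) < 17 := by
    refine lt_of_eq_of_lt ?_ h
    simp [hG, hA, hN, Matrix.cons_val]
    ring
  refine ⟨?_, ?_, ?_, ?_⟩
  · linarith [sq_nonneg ((-28)*a + (42)*b + (16)*c + (-3)*e), sq_nonneg ((-112)*a + (376)*c + (-165)*e), sq_nonneg ((3256)*a + (10655)*e)]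
  · linarith [sq_nonneg ((30)*a + (-28)*b + (-16)*c + (13)*e), sq_nonneg ((16)*b + (232)*c + (-31)*e), sq_nonneg ((2152)*b + (6053)*e)]
  · linarith [sq_nonneg ((30)*a + (-28)*b + (-16)*c + (13)*e), sq_nonneg ((238)*b + (16)*c + (137)*e), sq_nonneg ((-319)*c + (2512)*e)]
  · linarith [sq_nonneg ((30)*a + (-28)*b + (-16)*c + (13)*e), sq_nonneg ((238)*b + (16)*c + (137)*e), sq_nonneg ((1832)*c + (-319)*e)]

lemma case_18 : ∃ k ≤ 8, ∃ M : Matrix (Fin k) (Fin k) ℤ,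
    M.IsSymm ∧ QFPosDef M ∧ QFTight 18 M := by
  refine main_red 18 5 ![34, 23, 36, 39, 16, -5, -8, -16, 8, -22]
    [(0, 1, 1, 1), (1, 0, 1, 1), (0, 0, 0, 0), (0, 0, 1, 1), (-1, 1, 0, -1), (0, 1, 0, 0), (-1, 2, 1, 0), (-1, 1, 0, 0), (-1, 1, -1, -1), (0, 1, 1, 0), (0, 1, 2, 1), (1, 0, 0, 0), (-2, 2, 0, -1), (-1, 2, 2, 1)]
    (by norm_num) (by norm_num) (by norm_num) ?_ (by decide +kernel) (by decide +kernel)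
  intro a b c e h
  have h' : (29)*(a*a) + (18)*(b*b) + (31)*(c*c) + (34)*(e*e) + (32)*(a*b) + (-10)*(a*c) + (-21)*(a*e) + (-32)*(b*c) + (11)*(b*e) + (-49)*(c*e) < 18 := by
    refine lt_of_eq_of_lt ?_ h
    simp [hG, hA, hN, Matrix.cons_val]
    ring
  refine ⟨?_, ?_, ?_, ?_⟩
  · linarith [sq_nonneg ((32)*a + (36)*b + (-32)*c + (11)*e), sq_nonneg ((166)*a + (302)*c + (-353)*e), sq_nonneg ((-5568)*a + (11351)*e)]
  · linarith [sq_nonneg ((58)*a + (32)*b + (-10)*c + (-21)*e), sq_nonneg ((-384)*b + (874)*c + (-763)*e), sq_nonneg ((-466)*b + (12637)*e)]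
  · linarith [sq_nonneg ((58)*a + (32)*b + (-10)*c + (-21)*e), sq_nonneg ((532)*b + (-768)*c + (655)*e), sq_nonneg ((-10648)*c + (17337)*e)]
  · linarith [sq_nonneg ((58)*a + (32)*b + (-10)*c + (-21)*e), sq_nonneg ((532)*b + (-768)*c + (655)*e), sq_nonneg ((1466)*c + (-1331)*e)]

lemma case_19 : ∃ k ≤ 8, ∃ M : Matrix (Fin k) (Fin k) ℤ,
    M.IsSymm ∧ QFPosDef M ∧ QFTight 19 M := by
  refine main_red 19 5 ![23, 24, 31, 33, -13, -17, 7, 14, -11, -11]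
    [(1, 1, 1, 1), (0, 0, 0, 0), (1, 1, 0, 0), (2, 1, 1, 1), (1, 0, 0, 0), (0, 1, 0, 0), (0, 1, 0, 1), (1, 1, 0, 1), (0, -1, 1, 0), (2, 2, 1, 1), (1, 2, 0, 1), (0, 0, 1, 0), (2, 0, 2, 1)]
    (by norm_num) (by norm_num) (by norm_num) ?_ (by decide +kernel) (by decide +kernel)
  intro a b c e h
  have h' : (18)*(a*a) + (19)*(b*b) + (26)*(c*c) + (28)*(e*e) + (-26)*(a*b) + (-34)*(a*c) + (9)*(a*e) + (28)*(b*c) + (-27)*(b*e) + (-27)*(c*e) < 19 := by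
    refine lt_of_eq_of_lt ?_ h
    simp [hG, hA, hN, Matrix.cons_val]
    ring
  refine ⟨?_, ?_, ?_, ?_⟩
  · linarith [sq_nonneg ((-26)*a + (38)*b + (28)*c + (-27)*e), sq_nonneg ((-282)*a + (596)*c + (-135)*e), sq_nonneg ((-7650)*a + (20983)*e)]
  · linarith [sq_nonneg ((36)*a + (-26)*b + (-34)*c + (9)*e), sq_nonneg ((62)*b + (358)*c + (-333)*e), sq_nonneg ((-3096)*b + (6541)*e)]
  · linarith [sq_nonneg ((36)*a + (-26)*b + (-34)*c + (9)*e), sq_nonneg ((346)*b + (62)*c + (-369)*e), sq_nonneg ((-5130)*c + (11033)*e)]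
  · linarith [sq_nonneg ((36)*a + (-26)*b + (-34)*c + (9)*e), sq_nonneg ((346)*b + (62)*c + (-369)*e), sq_nonneg ((3334)*c + (-2565)*e)]

lemma case_20 : ∃ k ≤ 8, ∃ M : Matrix (Fin k) (Fin k) ℤ,
    M.IsSymm ∧ QFPosDef M ∧ QFTight 20 M := by
  refine main_red 20 5 ![26, 21, 43, 23, 11, -21, 2, -18, 11, -3]
    [(0, 0, 0, 0), (0, 1, 0, 0), (0, -1, 0, 1), (0, 0, 0, 1), (1, 1, 1, 0), (-1, 1, 0, 0), (1, 0, 0, 0), (1, 0, 1, 0), (0, 1, 1, 0), (-1, 2, 0, -1), (-1, 1, 0, -1), (0, 2, 1, 0), (-1, -1, -1, 1), (1, 0, 1, 1)]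
    (by norm_num) (by norm_num) (by norm_num) ?_ (by decide +kernel) (by decide +kernel)
  intro a b c e h
  have h' : (21)*(a*a) + (16)*(b*b) + (38)*(c*c) + (18)*(e*e) + (22)*(a*b) + (-42)*(a*c) + (-1)*(a*e) + (-36)*(b*c) + (17)*(b*e) + (-11)*(c*e) < 20 := by
    refine lt_of_eq_of_lt ?_ h
    simp [hG, hA, hN, Matrix.cons_val]
    ring
  refine ⟨?_, ?_, ?_, ?_⟩
  · linarith [sq_nonneg ((22)*a + (32)*b + (-36)*c + (17)*e), sq_nonneg ((-138)*a + (284)*c + (65)*e), sq_nonneg ((-2482)*a + (7131)*e)]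
  · linarith [sq_nonneg ((42)*a + (22)*b + (-42)*c + (-1)*e), sq_nonneg ((-7)*b + (17)*c + (-6)*e), sq_nonneg ((8984)*b + (22663)*e)]
  · linarith [sq_nonneg ((42)*a + (22)*b + (-42)*c + (-1)*e), sq_nonneg ((215)*b + (-147)*c + (184)*e), sq_nonneg ((-8)*c + (9021)*e)]
  · linarith [sq_nonneg ((42)*a + (22)*b + (-42)*c + (-1)*e), sq_nonneg ((215)*b + (-147)*c + (184)*e), sq_nonneg ((1313)*c + (-1)*e)]

lemma case_21 : ∃ k ≤ 8, ∃ M : Matrix (Fin k) (Fin k) ℤ,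
    M.IsSymm ∧ QFPosDef M ∧ QFTight 21 M := by
  refine main_red 21 6 ![28, 21, 44, 22, 13, -8, -6, -18, -2, 4]
    [(0, 1, 0, 0), (0, 0, 0, 1), (-1, 1, 0, 0), (0, 0, 0, 0), (-1, 1, 0, -1), (1, 0, 0, 1), (0, 1, 0, 1), (1, 0, 0, 0), (0, 1, 1, 0), (0, 2, 1, 1), (0, 1, 1, 1), (0, 2, 1, 0), (-1, 1, 1, 0), (-1, 2, 0, 0), (-1, 1, 0, 1)]
    (by norm_num) (by norm_num) (by norm_num) ?_ (by decide +kernel) (by decide +kernel)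
  intro a b c e h
  have h' : (22)*(a*a) + (15)*(b*b) + (38)*(c*c) + (16)*(e*e) + (26)*(a*b) + (-16)*(a*c) + (-18)*(a*e) + (-36)*(b*c) + (-10)*(b*e) + (2)*(c*e) < 21 := by
    refine lt_of_eq_of_lt ?_ h
    simp [hG, hA, hN, Matrix.cons_val]
    ring
  refine ⟨?_, ?_, ?_, ?_⟩
  · linarith [sq_nonneg ((13)*a + (15)*b + (-18)*c + (-5)*e), sq_nonneg ((38)*a + (82)*c + (-25)*e), sq_nonneg ((-578)*a + (3151)*e)]
  · linarith [sq_nonneg ((22)*a + (13)*b + (-8)*c + (-9)*e), sq_nonneg ((-146)*b + (386)*c + (-25)*e), sq_nonneg ((-209)*b + (4698)*e)]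
  · linarith [sq_nonneg ((22)*a + (13)*b + (-8)*c + (-9)*e), sq_nonneg ((161)*b + (-292)*c + (7)*e), sq_nonneg ((-39)*c + (283)*e)]
  · linarith [sq_nonneg ((22)*a + (13)*b + (-8)*c + (-9)*e), sq_nonneg ((161)*b + (-292)*c + (7)*e), sq_nonneg ((1774)*c + (-273)*e)]

/-- For `15 ≤ n ≤ 21`, `t(n) ≤ 8`. -/
theorem stmt_15 (n : ℕ) (h₁ : 15 ≤ n) (h₂ : n ≤ 21) :
    ∃ k ≤ 8, ∃ M : Matrix (Fin k) (Fin k) ℤ,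
      M.IsSymm ∧ QFPosDef M ∧ QFTight n M := by
  interval_cases n
  · exact case_15
  · exact case_16
  · exact case_17
  · exact case_18
  · exact case_19
  · exact case_20
  · exact case_21
end

section
/- For any integer n with 22 ≤ n ≤ 36, t(n) ≤ 9. -/
/-- the quinary part -/
def hv (a00 a01 a02 a03 a04 a11 a12 a13 a14 a22 a23 a24 a33 a34 a44 u v w x y : ℤ) : ℤ :=
  a00*u^2 + 2*a01*u*v + 2*a02*u*w + 2*a03*u*x + 2*a04*u*y + a11*v^2 + 2*a12*v*w + 2*a13*v*x + 2*a14*v*y + a22*w^2 + 2*a23*w*x + 2*a24*w*y + a33*x^2 + 2*a34*x*y + a44*y^2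

/-- number of odd entries -/
def wt (v w x y : ℤ) : ℤ := v % 2 + w % 2 + x % 2 + y % 2

/-- the form of rank nine -/
def MM (a00 a01 a02 a03 a04 a11 a12 a13 a14 a22 a23 a24 a33 a34 a44 : ℤ) : Matrix (Fin 9) (Fin 9) ℤ :=
  !![36, 0, 0, 0, 0, 18, 0, 0, 0; 0, 36, 0, 0, 0, 0, 18, 0, 0; 0, 0, 36, 0, 0, 0, 0, 18, 0; 0, 0, 0, 36, 0, 0, 0, 0, 18; 0, 0, 0, 0, a00, a01, a02, a03, a04; 18, 0, 0, 0, a01, a11+9, a12, a13, a14; 0, 18, 0, 0, a02, a12, a22+9, a23, a24; 0, 0, 18, 0, a03, a13, a23, a33+9, a34; 0, 0, 0, 18, a04, a14, a24, a34, a44+9]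

theorem MM_symm (a00 a01 a02 a03 a04 a11 a12 a13 a14 a22 a23 a24 a33 a34 a44 : ℤ) : (MM a00 a01 a02 a03 a04 a11 a12 a13 a14 a22 a23 a24 a33 a34 a44).IsSymm := by
  unfold MM
  ext i j
  fin_cases i <;> fin_cases j <;> rfl

theorem MM_val (a00 a01 a02 a03 a04 a11 a12 a13 a14 a22 a23 a24 a33 a34 a44 : ℤ) (z : Fin 9 → ℤ) :
    QFval (MM a00 a01 a02 a03 a04 a11 a12 a13 a14 a22 a23 a24 a33 a34 a44) z = 9 * ((2 * z 0 + z 5)^2 + (2 * z 1 + z 6)^2 + (2 * z 2 + z 7)^2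
      + (2 * z 3 + z 8)^2) + hv a00 a01 a02 a03 a04 a11 a12 a13 a14 a22 a23 a24 a33 a34 a44 (z 4) (z 5) (z 6) (z 7) (z 8) := by
  unfold QFval MM hv
  simp [Fin.sum_univ_succ]
  ring

def pd1 (a00 : ℤ) : Bool := decide (0 ≤ a00)

def pd2 (a00 a01 a11 : ℤ) : Bool :=
  decide (0 < a00) && pd1 (a00*a11-a01*a01)

def pd3 (a00 a01 a02 a11 a12 a22 : ℤ) : Bool :=
  decide (0 < a00) && pd2 (a00*a11-a01*a01) (a00*a12-a01*a02) (a00*a22-a02*a02)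

def pd4 (a00 a01 a02 a03 a11 a12 a13 a22 a23 a33 : ℤ) : Bool :=
  decide (0 < a00) && pd3 (a00*a11-a01*a01) (a00*a12-a01*a02) (a00*a13-a01*a03) (a00*a22-a02*a02) (a00*a23-a02*a03) (a00*a33-a03*a03)

def pd5 (a00 a01 a02 a03 a04 a11 a12 a13 a14 a22 a23 a24 a33 a34 a44 : ℤ) : Bool :=
  decide (0 < a00) && pd4 (a00*a11-a01*a01) (a00*a12-a01*a02) (a00*a13-a01*a03) (a00*a14-a01*a04) (a00*a22-a02*a02) (a00*a23-a02*a03) (a00*a24-a02*a04) (a00*a33-a03*a03) (a00*a34-a03*a04) (a00*a44-a04*a04)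

theorem pd1_ok (a00 : ℤ) (h : pd1 a00 = true) (u : ℤ) : 0 ≤ a00*u^2 := by
  simp only [pd1, decide_eq_true_eq] at h
  positivity

theorem pd2_ok (a00 a01 a11 : ℤ) (h : pd2 a00 a01 a11 = true) (u v : ℤ) :
    0 ≤ a00*u^2 + 2*a01*u*v + a11*v^2 := by
  simp only [pd2, Bool.and_eq_true, decide_eq_true_eq] at h
  have h1 := pd1_ok _ h.2 v
  have h2 : 0 ≤ a00 * (a00*u^2 + 2*a01*u*v + a11*v^2) := by
    have h3 := sq_nonneg ((a00*u + a01*v))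
    linarith
  exact nonneg_of_mul_nonneg_right h2 h.1

theorem pd3_ok (a00 a01 a02 a11 a12 a22 : ℤ) (h : pd3 a00 a01 a02 a11 a12 a22 = true) (u v w : ℤ) :
    0 ≤ a00*u^2 + 2*a01*u*v + 2*a02*u*w + a11*v^2 + 2*a12*v*w + a22*w^2 := by
  simp only [pd3, Bool.and_eq_true, decide_eq_true_eq] at h
  have h1 := pd2_ok _ _ _ h.2 v w
  have h2 : 0 ≤ a00 * (a00*u^2 + 2*a01*u*v + 2*a02*u*w + a11*v^2 + 2*a12*v*w + a22*w^2) := by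
    have h3 := sq_nonneg ((a00*u + a01*v + a02*w))
    linarith
  exact nonneg_of_mul_nonneg_right h2 h.1

theorem pd4_ok (a00 a01 a02 a03 a11 a12 a13 a22 a23 a33 : ℤ) (h : pd4 a00 a01 a02 a03 a11 a12 a13 a22 a23 a33 = true) (u v w x : ℤ) :
    0 ≤ a00*u^2 + 2*a01*u*v + 2*a02*u*w + 2*a03*u*x + a11*v^2 + 2*a12*v*w + 2*a13*v*x + a22*w^2 + 2*a23*w*x + a33*x^2 := by
  simp only [pd4, Bool.and_eq_true, decide_eq_true_eq] at h
  have h1 := pd3_ok _ _ _ _ _ _ h.2 v w x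
  have h2 : 0 ≤ a00 * (a00*u^2 + 2*a01*u*v + 2*a02*u*w + 2*a03*u*x + a11*v^2 + 2*a12*v*w + 2*a13*v*x + a22*w^2 + 2*a23*w*x + a33*x^2) := by
    have h3 := sq_nonneg ((a00*u + a01*v + a02*w + a03*x))
    linarith
  exact nonneg_of_mul_nonneg_right h2 h.1

theorem pd5_ok (a00 a01 a02 a03 a04 a11 a12 a13 a14 a22 a23 a24 a33 a34 a44 : ℤ) (h : pd5 a00 a01 a02 a03 a04 a11 a12 a13 a14 a22 a23 a24 a33 a34 a44 = true) (u v w x y : ℤ) :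
    0 ≤ a00*u^2 + 2*a01*u*v + 2*a02*u*w + 2*a03*u*x + 2*a04*u*y + a11*v^2 + 2*a12*v*w + 2*a13*v*x + 2*a14*v*y + a22*w^2 + 2*a23*w*x + 2*a24*w*y + a33*x^2 + 2*a34*x*y + a44*y^2 := by
  simp only [pd5, Bool.and_eq_true, decide_eq_true_eq] at h
  have h1 := pd4_ok _ _ _ _ _ _ _ _ _ _ h.2 v w x y
  have h2 : 0 ≤ a00 * (a00*u^2 + 2*a01*u*v + 2*a02*u*w + 2*a03*u*x + 2*a04*u*y + a11*v^2 + 2*a12*v*w + 2*a13*v*x + 2*a14*v*y + a22*w^2 + 2*a23*w*x + 2*a24*w*y + a33*x^2 + 2*a34*x*y + a44*y^2) := by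
    have h3 := sq_nonneg ((a00*u + a01*v + a02*w + a03*x + a04*y))
    linarith
  exact nonneg_of_mul_nonneg_right h2 h.1

/-- bounded-box certificate -/
def bnd (n a00 a01 a02 a03 a04 a11 a12 a13 a14 a22 a23 a24 a33 a34 a44 : ℤ) : Bool :=
  pd5 (9*a00-n) (9*a01) (9*a02) (9*a03) (9*a04) (9*a11) (9*a12) (9*a13) (9*a14) (9*a22) (9*a23) (9*a24) (9*a33) (9*a34) (9*a44) && 
  pd5 (9*a00) (9*a01) (9*a02) (9*a03) (9*a04) (9*a11-n) (9*a12) (9*a13) (9*a14) (9*a22) (9*a23) (9*a24) (9*a33) (9*a34) (9*a44) && 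
  pd5 (9*a00) (9*a01) (9*a02) (9*a03) (9*a04) (9*a11) (9*a12) (9*a13) (9*a14) (9*a22-n) (9*a23) (9*a24) (9*a33) (9*a34) (9*a44) && 
  pd5 (9*a00) (9*a01) (9*a02) (9*a03) (9*a04) (9*a11) (9*a12) (9*a13) (9*a14) (9*a22) (9*a23) (9*a24) (9*a33-n) (9*a34) (9*a44) && 
  pd5 (9*a00) (9*a01) (9*a02) (9*a03) (9*a04) (9*a11) (9*a12) (9*a13) (9*a14) (9*a22) (9*a23) (9*a24) (9*a33) (9*a34) (9*a44-n)

def rg : List ℤ := [-2, -1, 0, 1, 2]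

def low (n a00 a01 a02 a03 a04 a11 a12 a13 a14 a22 a23 a24 a33 a34 a44 : ℤ) : Bool :=
  rg.all fun u => rg.all fun v => rg.all fun w => rg.all fun x => rg.all fun y =>
    decide (n ≤ hv a00 a01 a02 a03 a04 a11 a12 a13 a14 a22 a23 a24 a33 a34 a44 u v w x y + 9 * wt v w x y) ||
      (decide (u = 0) && decide (v = 0) && decide (w = 0) && decide (x = 0) && decide (y = 0))

/-- decode a vector -/
def dc (c : ℕ) (i : ℕ) : ℤ := ((c / 5 ^ i % 5 : ℕ) : ℤ) - 2

def cov (n a00 a01 a02 a03 a04 a11 a12 a13 a14 a22 a23 a24 a33 a34 a44 : ℤ) (l : List ℕ) : Bool :=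
  (List.range 36).all fun r => l.any fun c =>
    let t := hv a00 a01 a02 a03 a04 a11 a12 a13 a14 a22 a23 a24 a33 a34 a44 (dc c 0) (dc c 1) (dc c 2) (dc c 3) (dc c 4)
      + 9 * wt (dc c 1) (dc c 2) (dc c 3) (dc c 4)
    decide (wt (dc c 1) (dc c 2) (dc c 3) (dc c 4) ≤ 3) && decide (t ≤ n + r) &&
      decide ((n + r - t) % 36 = 0)

theorem mem_rg (a : ℤ) (h : a ^ 2 < 9) : a ∈ rg := by
  have h1 : a < 3 := by nlinarith
  have h2 : -3 < a := by nlinarith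
  simp only [rg, List.mem_cons, List.not_mem_nil, or_false]
  omega

theorem odd_sq (a b : ℤ) : b % 2 ≤ (2 * a + b) ^ 2 := by
  rcases Int.emod_two_eq_zero_or_one b with h | h
  · rw [h]; positivity
  · rw [h]
    have : 2 * a + b ≠ 0 := by omega
    have := sq_pos_of_ne_zero this
    omega

theorem low_ok (n a00 a01 a02 a03 a04 a11 a12 a13 a14 a22 a23 a24 a33 a34 a44 : ℤ) (hn : 0 < n) (hb : bnd n a00 a01 a02 a03 a04 a11 a12 a13 a14 a22 a23 a24 a33 a34 a44 = true)
    (hl : low n a00 a01 a02 a03 a04 a11 a12 a13 a14 a22 a23 a24 a33 a34 a44 = true) (u v w x y : ℤ)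
    (h0 : ¬ (u = 0 ∧ v = 0 ∧ w = 0 ∧ x = 0 ∧ y = 0)) :
    n ≤ hv a00 a01 a02 a03 a04 a11 a12 a13 a14 a22 a23 a24 a33 a34 a44 u v w x y + 9 * wt v w x y := by
  have hw : 0 ≤ wt v w x y := by unfold wt; omega
  by_contra hc
  have hh : hv a00 a01 a02 a03 a04 a11 a12 a13 a14 a22 a23 a24 a33 a34 a44 u v w x y < n := by omega
  have hh0 := hh
  unfold hv at hh
  simp only [bnd, Bool.and_eq_true] at hb
  obtain ⟨⟨⟨⟨b0, b1⟩, b2⟩, b3⟩, b4⟩ := hb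
  have c0 := pd5_ok _ _ _ _ _ _ _ _ _ _ _ _ _ _ _ b0 u v w x y
  have c1 := pd5_ok _ _ _ _ _ _ _ _ _ _ _ _ _ _ _ b1 u v w x y
  have c2 := pd5_ok _ _ _ _ _ _ _ _ _ _ _ _ _ _ _ b2 u v w x y
  have c3 := pd5_ok _ _ _ _ _ _ _ _ _ _ _ _ _ _ _ b3 u v w x y
  have c4 := pd5_ok _ _ _ _ _ _ _ _ _ _ _ _ _ _ _ b4 u v w x y
  have hp : 0 ≤ hv a00 a01 a02 a03 a04 a11 a12 a13 a14 a22 a23 a24 a33 a34 a44 u v w x y := by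
    by_contra hneg
    unfold hv at hneg
    nlinarith [mul_nonneg hn.le (sq_nonneg u)]
  have m0 : u ∈ rg := mem_rg _ (by by_contra hq; push Not at hq; nlinarith [mul_le_mul_of_nonneg_left hq hn.le])
  have m1 : v ∈ rg := mem_rg _ (by by_contra hq; push Not at hq; nlinarith [mul_le_mul_of_nonneg_left hq hn.le])
  have m2 : w ∈ rg := mem_rg _ (by by_contra hq; push Not at hq; nlinarith [mul_le_mul_of_nonneg_left hq hn.le])
  have m3 : x ∈ rg := mem_rg _ (by by_contra hq; push Not at hq; nlinarith [mul_le_mul_of_nonneg_left hq hn.le])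
  have m4 : y ∈ rg := mem_rg _ (by by_contra hq; push Not at hq; nlinarith [mul_le_mul_of_nonneg_left hq hn.le])
  simp only [low, List.all_eq_true] at hl
  have := hl u m0 v m1 w m2 x m3 y m4
  simp only [Bool.or_eq_true, Bool.and_eq_true, decide_eq_true_eq] at this
  rcases this with h | h
  · exact hc h
  · exact h0 ⟨h.1.1.1.1, h.1.1.1.2, h.1.1.2, h.1.2, h.2⟩

theorem par_sq (a : ℤ) : a ^ 2 % 4 = a % 2 ∧ (a % 2 = 0 ∨ a % 2 = 1) := by
  rcases Int.even_or_odd' a with ⟨k, rfl | rfl⟩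
  · ring_nf; omega
  · ring_nf; omega

theorem bits (a b c d p q r s : ℤ) (ha : a = 0 ∨ a = 1) (hb : b = 0 ∨ b = 1) (hc : c = 0 ∨ c = 1) (hd : d = 0 ∨ d = 1) (hp : p = 0 ∨ p = 1) (hq : q = 0 ∨ q = 1) (hr : r = 0 ∨ r = 1) (hs : s = 0 ∨ s = 1)
    (h : a + b + c + d = p + q + r + s) :
    (a = p ∧ b = q ∧ c = r ∧ d = s) ∨
    (a = p ∧ b = q ∧ d = r ∧ c = s) ∨
    (a = p ∧ c = q ∧ b = r ∧ d = s) ∨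
    (a = p ∧ d = q ∧ c = r ∧ b = s) ∨
    (b = p ∧ a = q ∧ c = r ∧ d = s) ∨
    (b = p ∧ a = q ∧ d = r ∧ c = s) ∨
    (c = p ∧ b = q ∧ a = r ∧ d = s) ∨
    (c = p ∧ d = q ∧ a = r ∧ b = s) ∨
    (d = p ∧ b = q ∧ c = r ∧ a = s) ∨
    (d = p ∧ c = q ∧ b = r ∧ a = s) := by
  rcases ha with rfl | rfl <;> rcases hb with rfl | rfl <;> rcases hc with rfl | rfl <;>
  rcases hd with rfl | rfl <;> rcases hp with rfl | rfl <;> rcases hq with rfl | rfl <;>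
  rcases hr with rfl | rfl <;> rcases hs with rfl | rfl <;> revert h <;> decide

theorem exists_bit (p q r s a b c d : ℤ) (hp : p = 0 ∨ p = 1) (hq : q = 0 ∨ q = 1)
    (hr : r = 0 ∨ r = 1) (hs : s = 0 ∨ s = 1) (hw : p + q + r + s ≤ 3)
    (h : (a ^ 2 + b ^ 2 + c ^ 2 + d ^ 2) % 4 = p + q + r + s)
    (hne : p + q + r + s ≠ 0) :
    ∃ a' b' c' d' : ℤ, a' ^ 2 + b' ^ 2 + c' ^ 2 + d' ^ 2 = a ^ 2 + b ^ 2 + c ^ 2 + d ^ 2 ∧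
      a' % 2 = p ∧ b' % 2 = q ∧ c' % 2 = r ∧ d' % 2 = s := by
  obtain ⟨a1, a2⟩ := par_sq a
  obtain ⟨b1, b2⟩ := par_sq b
  obtain ⟨c1, c2⟩ := par_sq c
  obtain ⟨d1, d2⟩ := par_sq d
  have hsum : a % 2 + b % 2 + c % 2 + d % 2 = p + q + r + s := by omega
  rcases bits _ _ _ _ _ _ _ _ a2 b2 c2 d2 hp hq hr hs hsum with e | e | e | e | e | e | e | e | e | e
  · exact ⟨a, b, c, d, by ring, e⟩
  · exact ⟨a, b, d, c, by ring, e⟩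
  · exact ⟨a, c, b, d, by ring, e⟩
  · exact ⟨a, d, c, b, by ring, e⟩
  · exact ⟨b, a, c, d, by ring, e⟩
  · exact ⟨b, a, d, c, by ring, e⟩
  · exact ⟨c, b, a, d, by ring, e⟩
  · exact ⟨c, d, a, b, by ring, e⟩
  · exact ⟨d, b, c, a, by ring, e⟩
  · exact ⟨d, c, b, a, by ring, e⟩

theorem four (v w x y : ℤ) (k : ℕ) (h : wt v w x y ≤ 3) :
    ∃ a b c d : ℤ, (2 * a + v) ^ 2 + (2 * b + w) ^ 2 + (2 * c + x) ^ 2 + (2 * d + y) ^ 2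
      = 4 * k + wt v w x y := by
  have pv := (par_sq v).2
  have pw := (par_sq w).2
  have px := (par_sq x).2
  have py := (par_sq y).2
  have key : ∃ a b c d : ℤ, a ^ 2 + b ^ 2 + c ^ 2 + d ^ 2 = 4 * k + wt v w x y ∧
      a % 2 = v % 2 ∧ b % 2 = w % 2 ∧ c % 2 = x % 2 ∧ d % 2 = y % 2 := by
    by_cases h0 : wt v w x y = 0
    · obtain ⟨a, b, c, d, e⟩ := Nat.sum_four_squares k
      refine ⟨2 * a, 2 * b, 2 * c, 2 * d, ?_, ?_⟩
      · rw [h0, ← e]; push_cast; ring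
      · unfold wt at h0; omega
    · have hw0 : 0 ≤ wt v w x y := by unfold wt; omega
      obtain ⟨a, b, c, d, e⟩ := Nat.sum_four_squares (4 * k + (wt v w x y).toNat)
      have e' : (a : ℤ) ^ 2 + (b : ℤ) ^ 2 + (c : ℤ) ^ 2 + (d : ℤ) ^ 2 = 4 * k + wt v w x y := by
        have := congrArg (Nat.cast : ℕ → ℤ) e
        push_cast at this
        rw [this]; omega
      rw [← e']
      apply exists_bit _ _ _ _ _ _ _ _ pv pw px py h _ h0
      rw [e']; unfold wt at *; omega
  obtain ⟨a, b, c, d, e, ha, hb, hc, hd⟩ := key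
  refine ⟨(a - v) / 2, (b - w) / 2, (c - x) / 2, (d - y) / 2, ?_⟩
  rw [← e]
  congr 1 <;> [congr 1 <;> [congr 1 <;> congr 1; congr 1]; congr 1] <;> omega

theorem main (n : ℕ) (hn : 0 < n) (hn36 : n ≤ 36) (a00 a01 a02 a03 a04 a11 a12 a13 a14 a22 a23 a24 a33 a34 a44 : ℤ) (l : List ℕ)
    (hb : bnd n a00 a01 a02 a03 a04 a11 a12 a13 a14 a22 a23 a24 a33 a34 a44 = true)
    (hl : low n a00 a01 a02 a03 a04 a11 a12 a13 a14 a22 a23 a24 a33 a34 a44 = true) (hc : cov n a00 a01 a02 a03 a04 a11 a12 a13 a14 a22 a23 a24 a33 a34 a44 l = true) :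
    ∃ k ≤ 9, ∃ M : Matrix (Fin k) (Fin k) ℤ,
      M.IsSymm ∧ QFPosDef M ∧ QFTight n M := by
  have hmin : ∀ z : Fin 9 → ℤ, z ≠ 0 → (n : ℤ) ≤ QFval (MM a00 a01 a02 a03 a04 a11 a12 a13 a14 a22 a23 a24 a33 a34 a44) z := by
    intro z hz
    rw [MM_val]
    by_cases h0 : z 4 = 0 ∧ z 5 = 0 ∧ z 6 = 0 ∧ z 7 = 0 ∧ z 8 = 0
    · obtain ⟨e4, e5, e6, e7, e8⟩ := h0
      have : 1 ≤ (z 0)^2 + (z 1)^2 + (z 2)^2 + (z 3)^2 := by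
        by_contra hlt
        have q0 : z 0 = 0 := by
          by_contra q; have := sq_pos_of_ne_zero q; nlinarith [sq_nonneg (z 1), sq_nonneg (z 2), sq_nonneg (z 3)]
        have q1 : z 1 = 0 := by
          by_contra q; have := sq_pos_of_ne_zero q; nlinarith [sq_nonneg (z 0), sq_nonneg (z 2), sq_nonneg (z 3)]
        have q2 : z 2 = 0 := by
          by_contra q; have := sq_pos_of_ne_zero q; nlinarith [sq_nonneg (z 1), sq_nonneg (z 0), sq_nonneg (z 3)]
        have q3 : z 3 = 0 := by
          by_contra q; have := sq_pos_of_ne_zero q; nlinarith [sq_nonneg (z 1), sq_nonneg (z 2), sq_nonneg (z 0)]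
        apply hz
        funext i
        fin_cases i <;> assumption
      have hn' : (n : ℤ) ≤ 36 := by exact_mod_cast hn36
      rw [e4, e5, e6, e7, e8]
      unfold hv
      linarith
    · have h1 := low_ok n a00 a01 a02 a03 a04 a11 a12 a13 a14 a22 a23 a24 a33 a34 a44 (by exact_mod_cast hn) hb hl _ _ _ _ _ h0
      have h2 := odd_sq (z 0) (z 5)
      have h3 := odd_sq (z 1) (z 6)
      have h4 := odd_sq (z 2) (z 7)
      have h5 := odd_sq (z 3) (z 8)
      unfold wt at h1
      linarith
  have hn' : (0 : ℤ) < n := by exact_mod_cast hn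
  refine ⟨9, le_rfl, MM a00 a01 a02 a03 a04 a11 a12 a13 a14 a22 a23 a24 a33 a34 a44, MM_symm a00 a01 a02 a03 a04 a11 a12 a13 a14 a22 a23 a24 a33 a34 a44, fun z hz => lt_of_lt_of_le hn' (hmin z hz), ?_⟩
  intro m hm
  constructor
  · rintro ⟨z, rfl⟩
    apply hmin
    rintro rfl
    apply hm
    simp [QFval]
  · intro hnm
    simp only [cov, List.all_eq_true, List.any_eq_true, Bool.and_eq_true, decide_eq_true_eq] at hc
    obtain ⟨c, -, ⟨h3, h4⟩, h5⟩ := hc ((m - n) % 36).toNat (by rw [List.mem_range]; omega)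
    have hr : ((((m - n) % 36).toNat : ℕ) : ℤ) = (m - n) % 36 := by omega
    rw [hr] at h4 h5
    generalize dc c 0 = u at *
    generalize dc c 1 = v at *
    generalize dc c 2 = w at *
    generalize dc c 3 = x at *
    generalize dc c 4 = y at *
    obtain ⟨a, b, c, d, e⟩ := four v w x y
      ((m - (hv a00 a01 a02 a03 a04 a11 a12 a13 a14 a22 a23 a24 a33 a34 a44 u v w x y + 9 * wt v w x y)) / 36).toNat h3
    refine ⟨![a, b, c, d, u, v, w, x, y], ?_⟩
    rw [MM_val]
    change 9 * ((2 * a + v)^2 + (2 * b + w)^2 + (2 * c + x)^2 + (2 * d + y)^2)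
      + hv a00 a01 a02 a03 a04 a11 a12 a13 a14 a22 a23 a24 a33 a34 a44 u v w x y = m
    rw [e]
    omega

theorem stmt_16 (n : ℕ) (h₁ : 22 ≤ n) (h₂ : n ≤ 36) :
    ∃ k ≤ 9, ∃ M : Matrix (Fin k) (Fin k) ℤ,
      M.IsSymm ∧ QFPosDef M ∧ QFTight n M := by
  interval_cases n
  · exact main 22 (by norm_num) (by norm_num) 25 13 14 (-9) (-13) 18 11 6 (-8) 16 2 (-11) 19 3 14
      [936, 937, 1320, 1561, 1566, 1557, 1461, 1345, 1582, 1446, 2620, 1611, 2111, 1365, 1562, 1321, 1340, 695, 1360, 961, 1465, 1490, 2741, 820, 2596, 2207, 815, 2086, 306, 190, 310, 1581, 690, 1315, 185, 1460]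
      (by decide +kernel) (by decide +kernel) (by decide +kernel)
  · exact main 23 (by norm_num) (by norm_num) 23 (-8) 15 (-14) (-2) 15 (-15) 11 6 23 (-12) (-10) 19 (-5) 21
      [1436, 1557, 1586, 1532, 1621, 1437, 696, 1682, 1556, 1502, 691, 2427, 1591, 1562, 1466, 2307, 811, 1370, 1441, 2182, 661, 1495, 816, 877, 2361, 1802, 686, 720, 1551, 1345, 1526, 2432, 11, 1310, 1286, 685]
      (by decide +kernel) (by decide +kernel) (by decide +kernel)
  · exact main 24 (by norm_num) (by norm_num) 32 8 11 17 (-19) 29 (-11) 15 6 20 5 (-17) 19 (-7) 22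
      [1752, 936, 1686, 286, 1437, 1537, 506, 937, 261, 1061, 1806, 941, 1562, 1777, 381, 1131, 1036, 1126, 505, 1781, 501, 535, 315, 410, 71, 882, 1681, 1185, 510, 816, 1566, 1776, 511, 530, 1161, 2241]
      (by decide +kernel) (by decide +kernel) (by decide +kernel)
  · exact main 25 (by norm_num) (by norm_num) 29 14 11 (-3) 3 21 (-2) 14 20 24 (-11) (-16) 23 24 33
      [1321, 2062, 1446, 2586, 1561, 1557, 1566, 2182, 2827, 1682, 1941, 1562, 2561, 1591, 941, 1586, 321, 937, 2061, 1320, 1946, 2177, 2736, 2711, 1936, 2591, 1970, 1445, 2236, 1966, 1470, 1711, 2066, 2615, 2856, 421]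
      (by decide +kernel) (by decide +kernel) (by decide +kernel)
  · exact main 26 (by norm_num) (by norm_num) 32 (-12) 5 19 (-27) 17 (-14) 0 4 21 (-12) 6 30 (-28) 40
      [1557, 936, 1532, 1711, 1537, 1377, 1561, 1686, 1556, 1681, 1562, 931, 1866, 1437, 1502, 627, 1527, 1741, 1860, 1382, 1531, 632, 811, 186, 2307, 2461, 1, 1676, 1507, 930, 776, 925, 335, 901, 1110, 1651]
      (by decide +kernel) (by decide +kernel) (by decide +kernel)
  · exact main 27 (by norm_num) (by norm_num) 31 12 12 (-22) (-12) 18 11 (-16) 4 19 (-5) (-5) 31 (-2) 21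
      [1436, 1537, 811, 937, 1561, 941, 1582, 1566, 1586, 1562, 936, 1456, 1326, 1437, 1461, 1452, 1476, 1350, 946, 685, 296, 1427, 2182, 1481, 190, 916, 705, 725, 186, 185, 815, 1412, 1355, 681, 1330, 1441]
      (by decide +kernel) (by decide +kernel) (by decide +kernel)
  · exact main 28 (by norm_num) (by norm_num) 44 (-20) (-11) 18 (-8) 20 (-2) (-12) 13 19 7 (-3) 20 (-9) 19
      [2375, 1661, 1786, 2182, 3000, 1755, 1432, 1531, 1562, 1686, 1656, 812, 2151, 1636, 1526, 2380, 1750, 1625, 1631, 2250, 2801, 2276, 1681, 2381, 3025, 2926, 2400, 1791, 911, 1506, 1630, 2275, 1501, 1780, 3026, 1650]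
      (by decide +kernel) (by decide +kernel) (by decide +kernel)
  · exact main 29 (by norm_num) (by norm_num) 32 (-13) (-17) (-2) (-15) 21 (-5) (-19) 22 30 28 (-11) 44 (-32) 37
      [1636, 1557, 1531, 61, 811, 2387, 812, 1562, 1426, 1661, 1537, 2287, 186, 2177, 806, 1761, 1432, 1357, 1431, 56, 1526, 55, 1631, 1500, 706, 885, 1327, 880, 1630, 161, 1525, 60, 1635, 675, 910, 50]
      (by decide +kernel) (by decide +kernel) (by decide +kernel)
  · exact main 30 (by norm_num) (by norm_num) 42 (-20) (-3) 8 12 30 (-7) (-19) (-14) 25 18 (-12) 24 1 21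
      [1137, 1662, 512, 1437, 1432, 1332, 1562, 907, 251, 282, 252, 1556, 1561, 257, 52, 387, 1457, 152, 2186, 1982, 1761, 1661, 1431, 177, 276, 376, 901, 906, 1301, 1686, 676, 1637, 1786, 507, 876, 882]
      (by decide +kernel) (by decide +kernel) (by decide +kernel)
  · exact main 31 (by norm_num) (by norm_num) 41 (-24) (-20) (-23) (-4) 55 9 (-15) 25 24 21 9 42 (-8) 22
      [937, 1431, 1537, 1536, 1925, 1562, 2056, 2650, 2156, 2550, 2756, 2262, 2675, 1331, 1456, 1950, 2887, 2750, 1325, 731, 1437, 2755, 811, 2050, 2161, 1300, 1351, 1457, 2387, 2136, 1430, 2776, 2625, 1976, 2775, 836]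
      (by decide +kernel) (by decide +kernel) (by decide +kernel)
  · exact main 32 (by norm_num) (by norm_num) 33 12 (-2) (-9) (-17) 26 (-14) 19 (-12) 23 (-25) 19 43 (-15) 30
      [1537, 1561, 1412, 1557, 1562, 2012, 936, 816, 1441, 991, 811, 966, 245, 1411, 1416, 695, 70, 1682, 932, 365, 1591, 1261, 996, 65, 95, 1296, 220, 186, 1291, 1536, 815, 486, 370, 670, 696, 1436]
      (by decide +kernel) (by decide +kernel) (by decide +kernel)
  · exact main 33 (by norm_num) (by norm_num) 39 11 12 (-3) 1 28 20 (-4) (-14) 27 11 (-25) 25 (-23) 40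
      [1582, 1477, 912, 1562, 1557, 807, 1561, 1352, 727, 2232, 702, 52, 787, 2236, 2986, 2211, 937, 682, 1586, 707, 2231, 1481, 2861, 77, 1461, 932, 2316, 1602, 827, 1356, 1351, 2336, 2227, 726, 1436, 1456]
      (by decide +kernel) (by decide +kernel) (by decide +kernel)
  · exact main 34 (by norm_num) (by norm_num) 34 (-11) 21 10 12 32 (-29) 17 (-6) 43 (-4) 19 34 19 28
      [1561, 1532, 1562, 1057, 551, 1176, 552, 581, 1681, 1437, 1586, 557, 2157, 2186, 2037, 1591, 1682, 2162, 1657, 1556, 1181, 1152, 586, 1686, 1182, 1651, 1027, 486, 1621, 582, 1527, 556, 991, 961, 610, 1616]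
      (by decide +kernel) (by decide +kernel) (by decide +kernel)
  · exact main 35 (by norm_num) (by norm_num) 51 22 8 (-20) (-27) 29 10 6 (-20) 31 18 5 33 11 30
      [1441, 1562, 932, 836, 937, 1537, 1461, 1437, 1466, 110, 1566, 1662, 735, 2071, 331, 961, 1561, 1946, 740, 1971, 1336, 327, 1446, 1340, 2062, 811, 1366, 235, 715, 1370, 306, 210, 336, 1320, 2162, 941]
      (by decide +kernel) (by decide +kernel) (by decide +kernel)
  · exact main 36 (by norm_num) (by norm_num) 37 18 (-3) 1 18 28 (-19) (-16) 10 28 10 (-14) 38 17 32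
      [1562, 1561, 1566, 2057, 2216, 2711, 2186, 1591, 1596, 2611, 2736, 1437, 2552, 1621, 912, 1691, 2870, 2245, 2062, 2241, 2582, 2061, 1696, 2745, 2740, 1071, 2116, 2191, 512, 2577, 1196, 2581, 1536, 1927, 2220, 2027]
      (by decide +kernel) (by decide +kernel) (by decide +kernel)
end

section
/- For any positive integer n, t(n) ≥ 4 and 2^{t(n)} ≥ n + 4 (equivalently, max(4, log₂(n+4)) ≤ t(n)). In particular, t(n) tends to infinity as n increases. -/
/-- the modulus used by the finite check -/
abbrev WW : ℕ := 1073741824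

/-- minus one modulo `WW` -/
abbrev NO : ℕ := 1073741823

/-- evaluate the argument first -/
def frc (n : ℕ) (f : ℕ → Bool) : Bool := Nat.casesOn n (f 0) (fun m => f (Nat.succ m))

/-- loop over `0 .. s-1` -/
def lpp (f : ℕ → Bool) (s : ℕ) : Bool := Nat.rec true (fun m ih => (f m).and ih) s

/-- try `t, ..., t+s-1`, smallest first -/
def tryT (f : ℕ → Bool) (s : ℕ) : ℕ → Bool :=
  Nat.rec (fun _ => false) (fun _ ih t => (f t).or (ih (Nat.succ t))) s

def noRep (a b c p q r D t : ℕ) : Bool :=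
  frc (Nat.mod (b*c+NO*(r*r)) WW) fun A =>
  frc (Nat.mod (a*c+NO*(q*q)) WW) fun B =>
  frc (Nat.mod (a*b+NO*(p*p)) WW) fun C =>
  frc (Nat.mod (2*(q*r+NO*(p*c))) WW) fun P =>
  frc (Nat.mod (p*r+NO*(q*b)) WW) fun Q =>
  frc (Nat.mod (p*q+NO*(r*a)) WW) fun R =>
  lpp (fun x =>
    (Nat.ble (Nat.succ (Nat.mul a t)) (Nat.mul x x)).or (
    frc (Nat.mod (A*x*x+NO*(t*D)) WW) fun Ax =>
    frc (Nat.mod (P*x) WW) fun Px =>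
    frc (Nat.mod (Q*x) WW) fun Qx =>
    lpp (fun y' => frc (Nat.add y' 1073741816) fun y =>
      (Nat.ble (Nat.succ (Nat.mul b t)) (Nat.mod (Nat.mul y y) WW)).or (
      frc (Nat.mod (Nat.add Ax (Nat.mul (Nat.add (Nat.mul B y) Px) y)) WW) fun k =>
      frc (Nat.mod (Nat.add Qx (Nat.mul R y)) WW) fun h =>
      (Nat.beq (Nat.land (Nat.shiftRight 144680414395695635
        (Nat.mod (Nat.add (Nat.mul h h) (Nat.mul NO (Nat.mul C k))) 64)) 1) 0).or (
      lpp (fun z' => frc (Nat.add z' 1073741813) fun z =>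
        (Nat.beq (Nat.mod (Nat.add (Nat.mul (Nat.add (Nat.mul C z) (Nat.mul 2 h)) z) k) WW) 0).not)
        23))) 17)) 10

def chk3 (a b c p q r : ℕ) : Bool :=
  frc (Nat.mod (a*b*c+2*p*q*r+NO*(a*(r*r)+b*(q*q)+c*(p*p))) WW) fun D =>
  (Nat.ble 1000 D).or (tryT (fun t => noRep a b c p q r D t) 15 4)

def chkp (c p : ℕ) : Bool :=
  lpp (fun q => lpp (fun r' => frc (Nat.add r' 1073741819) fun r => chk3 5 4 c p q r) 11) 6

theorem chk_0 : chkp 7 0 = true := by decide +kernel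
theorem chk_1 : chkp 6 1 = true := by decide +kernel
theorem chk_2 : chkp 6 2 = true := by decide +kernel
theorem chk_3 : chkp 6 3 = true := by decide +kernel
theorem chk_4 : chkp 6 4 = true := by decide +kernel

theorem frc_eq (n : ℕ) (f : ℕ → Bool) : frc n f = f n := by cases n <;> rfl

theorem lpp_spec {f : ℕ → Bool} {s : ℕ} (h : lpp f s = true) : ∀ m < s, f m = true := by
  induction s with
  | zero => intro m hm; omega
  | succ s ih =>
    have h' : ((f s).and (lpp f s)) = true := h
    rw [Bool.and_eq_true] at h'
    intro m hm
    rcases Nat.lt_succ_iff_lt_or_eq.mp hm with h1 | h1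
    · exact ih h'.2 m h1
    · rw [h1]; exact h'.1

theorem tryT_spec {f : ℕ → Bool} {s : ℕ} : ∀ {t : ℕ}, tryT f s t = true →
    ∃ u, t ≤ u ∧ u < t + s ∧ f u = true := by
  induction s with
  | zero => intro t h; exact absurd h (by simp [tryT])
  | succ s ih =>
    intro t h
    have h' : ((f t).or (tryT f s (Nat.succ t))) = true := h
    rw [Bool.or_eq_true] at h'
    rcases h' with h1 | h1
    · exact ⟨t, le_rfl, by omega, h1⟩
    · obtain ⟨u, h2, h3, h4⟩ := ih h1
      exact ⟨u, by omega, by omega, h4⟩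

theorem NO_cast : ((NO : ℕ) : ZMod WW) = -1 := by
  have : (((NO + 1 : ℕ)) : ZMod WW) = 0 := ZMod.natCast_self WW
  push_cast at this
  exact eq_neg_of_add_eq_zero_left this

theorem enc_cast (K s : ℕ) (hK : K + s = WW) (y : ℤ) (h : -(s:ℤ) ≤ y) :
    (((y + s).toNat + K : ℕ) : ZMod WW) = (y : ZMod WW) := by
  have h1 : (((y + s).toNat + K : ℕ) : ℤ) = y + (WW : ℕ) := by
    rw [← hK]; push_cast; rw [Int.toNat_of_nonneg (by omega)]; ring
  have h2 := congrArg (Int.cast : ℤ → ZMod WW) h1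
  rw [Int.cast_natCast] at h2
  rw [h2, Int.cast_add, Int.cast_natCast, ZMod.natCast_self, add_zero]

theorem sq_tab : ∀ u < 64, Nat.beq (Nat.land (Nat.shiftRight 144680414395695635
    (Nat.mod (u*u) 64)) 1) 0 = false := by decide

theorem y_tab : ∀ u < 17, Nat.mod (Nat.mul (u+1073741816) (u+1073741816)) WW
    = (((u:ℤ)-8)*((u:ℤ)-8)).toNat := by decide

theorem noRep_sound {a b c p q r' D' t : ℕ} {r D : ℤ} (hr : (r' : ZMod WW) = (r : ZMod WW))
    (hD : (D' : ZMod WW) = (D : ZMod WW)) (h : noRep a b c p q r' D' t = true)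
    (x : ℕ) (hx : x < 10) (hxa : x*x ≤ a*t) (y z : ℤ) (hy : -8 ≤ y) (hy' : y ≤ 8)
    (hyb : y*y ≤ b*t) (hz : -11 ≤ z) (hz' : z ≤ 11)
    (heq : (b*c-r*r)*x*x+(a*c-q*q)*y*y+((a:ℤ)*b-p*p)*z*z+2*(q*r-p*c)*x*y
      +2*(p*r-q*b)*x*z+2*(p*q-r*a)*y*z - t*D = 0) : False := by
  simp only [noRep, frc_eq] at h
  have h1 := lpp_spec h x hx
  rw [Bool.or_eq_true] at h1
  rcases h1 with h1 | h1
  · have := Nat.le_of_ble_eq_true h1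
    simp only [Nat.mul_eq] at this
    omega
  have h2 := lpp_spec h1 (y+8).toNat (by omega)
  clear h h1
  rw [Bool.or_eq_true] at h2
  rcases h2 with h2 | h2
  · have h3 := Nat.le_of_ble_eq_true h2
    have h4 := y_tab (y+8).toNat (by omega)
    simp only [Nat.add_eq] at h3
    rw [h4, Int.toNat_of_nonneg (by omega)] at h3
    simp only [Nat.mul_eq] at h3
    have h5 : (y + 8 - 8) * (y+8-8) = y * y := by ring
    rw [h5] at h3
    have h6 : ((b*t : ℕ) : ℤ) < y*y := by
      have := mul_self_nonneg y
      omega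
    push_cast at h6
    omega
  have ey := enc_cast 1073741816 8 rfl y hy
  have ez := enc_cast 1073741813 11 rfl z hz
  simp only [Nat.cast_ofNat] at ey ez
  have heq' := congrArg (Int.cast : ℤ → ZMod WW) heq
  push_cast at heq'
  have hno := NO_cast
  simp only [Nat.add_eq] at h2
  have ey' : (((y + 8).toNat + 1073741816 : ℕ) : ZMod WW) = (y : ZMod WW) := ey
  have ez' : (((z + 11).toNat + 1073741813 : ℕ) : ZMod WW) = (z : ZMod WW) := ez
  clear ey ez hy' hyb
  generalize (y + 8).toNat + 1073741816 = Y at h2 ey'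
  rw [Bool.or_eq_true] at h2
  have hmod : ∀ n : ℕ, ((Nat.mod n WW : ℕ) : ZMod WW) = (n : ZMod WW) :=
    fun n => ZMod.natCast_mod n WW
  rcases h2 with h2 | h2
  · generalize hheq : Nat.mod (Nat.add (Nat.mod _ WW) _) WW = H at h2
    generalize hk : Nat.mod (Nat.add (Nat.mod _ WW) _) WW = k at h2
    generalize hC : Nat.mod _ WW = C at h2
    have hk' := congrArg (Nat.cast : ℕ → ZMod WW) hk
    have hh' := congrArg (Nat.cast : ℕ → ZMod WW) hheq
    have hC' := congrArg (Nat.cast : ℕ → ZMod WW) hC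
    simp only [Nat.add_eq, Nat.mul_eq, hmod, Nat.cast_add, Nat.cast_mul, hno, hr, ey', hD] at hk' hh' hC'
    set u := C * ((z + 11).toNat + 1073741813) + H with hu
    have hu' : (u : ZMod WW) = C * z + H := by
      rw [hu, Nat.cast_add, Nat.cast_mul, ez']
    have e1 : ((H*H + NO*(C*k) : ℕ) : ZMod WW) = ((u*u : ℕ) : ZMod WW) := by
      rw [Nat.cast_add, Nat.cast_mul, Nat.cast_mul, Nat.cast_mul, Nat.cast_mul, hno, hu']
      have : (k : ZMod WW) + 2*H*z + C*z*z = 0 := by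
        rw [← hk', ← hh', ← hC', ← heq']; push_cast; ring
      linear_combination (-(C : ZMod WW)) * this
    have e2 : (H*H + NO*(C*k)) ≡ u*u [MOD 64] :=
      ((ZMod.natCast_eq_natCast_iff _ _ _).mp e1).of_dvd (by decide)
    have e3 : (H*H + NO*(C*k)) % 64 = ((u%64)*(u%64)) % 64 := by
      rw [← Nat.mul_mod]; exact e2
    simp only [Nat.add_eq, Nat.mul_eq] at h2
    have e4 := sq_tab (u % 64) (Nat.mod_lt _ (by norm_num))
    have e5 : Nat.mod (H*H + NO*(C*k)) 64 = Nat.mod ((u%64)*(u%64)) 64 := e3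
    rw [e5, e4] at h2
    exact Bool.noConfusion h2
  · have h3 := lpp_spec h2 (z+11).toNat (by omega)
    generalize hZ : (z + 11).toNat + 1073741813 = Z at h3 ez'
    rw [Bool.not_eq_true'] at h3
    have h4 := Nat.ne_of_beq_eq_false h3
    apply h4
    apply Nat.mod_eq_zero_of_dvd
    rw [← ZMod.natCast_eq_zero_iff]
    simp only [Nat.add_eq, Nat.mul_eq, hmod, Nat.cast_add, Nat.cast_mul, hno, hr, ey', ez', hD]
    rw [← heq']; push_cast; ring

theorem chkp_sound {c p : ℕ} (h : chkp c p = true) (q : ℕ) (hq : q < 6) (r : ℤ)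
    (hr : -5 ≤ r) (hr' : r ≤ 5) (D : ℤ)
    (hD : D = 5*4*c+2*p*q*r-(5*(r*r)+4*(q*q)+c*(p*p))) (hD0 : 0 ≤ D) (hD1 : D < 1000) :
    ∃ t : ℕ, 4 ≤ t ∧ t < 19 ∧ ∀ (x : ℕ), x*x ≤ 5*t → ∀ y z : ℤ, y*y ≤ 4*t → z*z ≤ 126 →
    (4*c-r*r)*x*x+(5*c-q*q)*y*y+((5:ℤ)*4-p*p)*z*z+2*(q*r-p*c)*x*y
      +2*(p*r-q*4)*x*z+2*(p*q-r*5)*y*z - t*D ≠ 0 := by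
  have h1 := lpp_spec h q hq
  have h2 := lpp_spec h1 (r+5).toNat (by omega)
  rw [frc_eq] at h2
  have er := enc_cast 1073741819 5 rfl r hr
  have er' : ((Nat.add (r + 5).toNat 1073741819 : ℕ) : ZMod WW) = (r : ZMod WW) := er
  generalize Nat.add (r + 5).toNat 1073741819 = r' at h2 er'
  rw [chk3, frc_eq] at h2
  generalize hDD : Nat.mod _ WW = D' at h2
  have hmod : ∀ n : ℕ, ((Nat.mod n WW : ℕ) : ZMod WW) = (n : ZMod WW) :=
    fun n => ZMod.natCast_mod n WW
  have hDc : (D' : ZMod WW) = (D : ZMod WW) := by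
    rw [← hDD, hmod, hD]
    simp only [Nat.cast_add, Nat.cast_mul, NO_cast, er']
    push_cast; ring
  have hDlt : D' < WW := by rw [← hDD]; exact Nat.mod_lt _ (by decide)
  have hDe : (D' : ℤ) = D := by
    have h3 : ((D' : ℤ) : ZMod WW) = (D : ZMod WW) := by rw [Int.cast_natCast]; exact hDc
    rw [ZMod.intCast_eq_intCast_iff] at h3
    have h4 : (D' : ℤ) % ((WW : ℕ) : ℤ) = D % ((WW : ℕ) : ℤ) := h3
    rw [Int.emod_eq_of_lt (by omega) (by omega),
      Int.emod_eq_of_lt hD0 (by simp only [WW]; omega)] at h4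
    exact h4
  rw [Bool.or_eq_true] at h2
  rcases h2 with h2 | h2
  · have := Nat.le_of_ble_eq_true h2
    omega
  obtain ⟨t, ht1, ht2, ht3⟩ := tryT_spec h2
  refine ⟨t, ht1, by omega, ?_⟩
  intro x hx y z hy hz heq
  refine noRep_sound er' hDc ht3 x (by nlinarith) hx y z (by nlinarith) (by nlinarith)
    (by push_cast; exact hy) (by nlinarith) (by nlinarith) ?_
  push_cast
  exact heq

/-- the bilinear form -/
def BB {k : ℕ} (M : Matrix (Fin k) (Fin k) ℤ) (x y : Fin k → ℤ) : ℤ :=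
  ∑ i, ∑ j, M i j * x i * y j

section
variable {k : ℕ} {M : Matrix (Fin k) (Fin k) ℤ}

theorem BB_add_left (x y z : Fin k → ℤ) : BB M (x + y) z = BB M x z + BB M y z := by
  simp only [BB, ← Finset.sum_add_distrib, Pi.add_apply]
  refine Finset.sum_congr rfl fun i _ => Finset.sum_congr rfl fun j _ => by ring

theorem BB_smul_left (c : ℤ) (x z : Fin k → ℤ) : BB M (c • x) z = c * BB M x z := by
  simp only [BB, Finset.mul_sum, Pi.smul_apply, smul_eq_mul]
  refine Finset.sum_congr rfl fun i _ => Finset.sum_congr rfl fun j _ => by ring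

theorem BB_comm (hs : M.IsSymm) (x y : Fin k → ℤ) : BB M x y = BB M y x := by
  unfold BB
  rw [Finset.sum_comm]
  refine Finset.sum_congr rfl fun i _ => Finset.sum_congr rfl fun j _ => ?_
  rw [hs.apply i j]; ring

theorem BB_add_right (hs : M.IsSymm) (x y z : Fin k → ℤ) :
    BB M x (y + z) = BB M x y + BB M x z := by
  rw [BB_comm hs, BB_add_left, BB_comm hs y, BB_comm hs z]

theorem BB_smul_right (hs : M.IsSymm) (c : ℤ) (x z : Fin k → ℤ) :
    BB M x (c • z) = c * BB M x z := by
  rw [BB_comm hs, BB_smul_left, BB_comm hs z]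

theorem QF_eq (x : Fin k → ℤ) : QFval M x = BB M x x := rfl

theorem BB_zero_left (z : Fin k → ℤ) : BB M 0 z = 0 := by
  simp [BB]

theorem BB_nonneg (hpd : QFPosDef M) (x : Fin k → ℤ) : 0 ≤ BB M x x := by
  by_cases h : x = 0
  · rw [h, BB_zero_left]
  · exact (hpd x h).le

theorem BB_cs (hs : M.IsSymm) (hpd : QFPosDef M) (u v : Fin k → ℤ) (hu : 0 < BB M u u) :
    BB M u v * BB M u v ≤ BB M u u * BB M v v := by
  have h := BB_nonneg hpd (BB M u u • v + (-BB M u v) • u)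
  simp only [BB_add_left, BB_smul_left, BB_add_right hs, BB_smul_right hs, BB_comm hs v u] at h
  have h2 : 0 ≤ BB M u u * (BB M u u * BB M v v - BB M u v * BB M u v) := by
    linarith
  have := nonneg_of_mul_nonneg_right h2 hu
  linarith

theorem BB_det3 (hs : M.IsSymm) (hpd : QFPosDef M) (u v w : Fin k → ℤ) (a b c p q r : ℤ)
    (ha : BB M u u = a) (hb : BB M v v = b) (hc : BB M w w = c)
    (hp : BB M u v = p) (hq : BB M u w = q) (hr : BB M v w = r) (hC : 0 < a*b-p*p) :
    0 ≤ a*b*c+2*p*q*r-(a*(r*r)+b*(q*q)+c*(p*p)) := by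
  have h := BB_nonneg hpd ((p*r-q*b) • u + (p*q-r*a) • v + (a*b-p*p) • w)
  simp only [BB_add_left, BB_smul_left, BB_add_right hs, BB_smul_right hs, BB_comm hs v u,
    BB_comm hs w u, BB_comm hs w v, ha, hb, hc, hp, hq, hr] at h
  refine nonneg_of_mul_nonneg_right (a := a*b-p*p) ?_ hC
  linarith

theorem BB_det4 (hs : M.IsSymm) (hk : k ≤ 3) (u v w s : Fin k → ℤ) (a b c p q r x y z t : ℤ)
    (ha : BB M u u = a) (hb : BB M v v = b) (hc : BB M w w = c)
    (hp : BB M u v = p) (hq : BB M u w = q) (hr : BB M v w = r)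
    (hx : BB M u s = x) (hy : BB M v s = y) (hz : BB M w s = z) (ht : BB M s s = t) :
    (b*c-r*r)*x*x+(a*c-q*q)*y*y+(a*b-p*p)*z*z+2*(q*r-p*c)*x*y
      +2*(p*r-q*b)*x*z+2*(p*q-r*a)*y*z
      - t*(a*b*c+2*p*q*r-(a*(r*r)+b*(q*q)+c*(p*p))) = 0 := by
  have hdep : ¬ LinearIndependent ℤ (![u, v, w, s]) := by
    intro h
    have := h.fintype_card_le_finrank
    simp at this
    omega
  rw [Fintype.not_linearIndependent_iff] at hdep
  obtain ⟨g, hg, hg0⟩ := hdep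
  have hrel : ∀ e : Fin k → ℤ,
      g 0 * BB M e u + g 1 * BB M e v + g 2 * BB M e w + g 3 * BB M e s = 0 := by
    intro e
    have h1 : g 0 • u + g 1 • v + g 2 • w + g 3 • s = 0 := by
      rw [← hg]; simp [Fin.sum_univ_four]
    have h2 : BB M e (g 0 • u + g 1 • v + g 2 • w + g 3 • s) = 0 := by
      rw [h1, BB_comm hs, BB_zero_left]
    simpa only [BB_add_right hs, BB_smul_right hs] using h2
  have hdet : (!![a,p,q,x;p,b,r,y;q,r,c,z;x,y,z,t] : Matrix (Fin 4) (Fin 4) ℤ).det = 0 := by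
    rw [← Matrix.exists_mulVec_eq_zero_iff]
    refine ⟨g, ?_, ?_⟩
    · rintro rfl
      obtain ⟨i, hi⟩ := hg0
      exact hi rfl
    · have e1 := hrel u
      have e2 := hrel v
      have e3 := hrel w
      have e4 := hrel s
      simp only [BB_comm hs v u, BB_comm hs w u, BB_comm hs w v, BB_comm hs s u, BB_comm hs s v,
        BB_comm hs s w, ha, hb, hc, hp, hq, hr, hx, hy, hz, ht] at e1 e2 e3 e4
      funext i
      fin_cases i <;> simp [Matrix.mulVec, dotProduct, Fin.sum_univ_four] <;> linarith
  simp [Matrix.det_succ_row_zero, Fin.sum_univ_succ, Fin.succAbove] at hdet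
  linarith

theorem exists_pos (hs : M.IsSymm) (hrep : ∀ m : ℤ, 4 ≤ m → QFRep M m) (u : Fin k → ℤ)
    (m : ℤ) (hm : 4 ≤ m) : ∃ v, BB M v v = m ∧ 0 ≤ BB M u v := by
  obtain ⟨v, hv⟩ := hrep m hm
  rcases le_total 0 (BB M u v) with h | h
  · exact ⟨v, hv, h⟩
  · refine ⟨(-1 : ℤ) • v, ?_, ?_⟩
    · rw [BB_smul_left, BB_smul_right hs, ← QF_eq, hv]; ring
    · rw [BB_smul_right hs]; linarith

theorem no_ternary_aux (hs : M.IsSymm) (hpd : QFPosDef M) (hk : k ≤ 3)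
    (hrep : ∀ m : ℤ, 4 ≤ m → QFRep M m) (u v : Fin k → ℤ) (hu : BB M u u = 5)
    (hv : BB M v v = 4) (p c : ℕ) (hp : BB M u v = p) (hp4 : p ≤ 4) (hc : 4 ≤ c) (hc7 : c ≤ 7)
    (h : chkp c p = true) : False := by
  obtain ⟨w, hw, hq⟩ := exists_pos hs hrep u c (by exact_mod_cast hc)
  obtain ⟨q, hq⟩ := Int.eq_ofNat_of_zero_le hq
  generalize hr : BB M v w = r
  have c1 := BB_cs hs hpd u w (by omega)
  have c2 := BB_cs hs hpd v w (by omega)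
  rw [hu, hw, hq] at c1
  rw [hv, hw, hr] at c2
  have hc7' : (c : ℤ) ≤ 7 := by exact_mod_cast hc7
  have hq6 : q < 6 := by
    have : (q : ℤ) < 6 := by nlinarith
    exact_mod_cast this
  have hr1 : -5 ≤ r := by nlinarith
  have hr2 : r ≤ 5 := by nlinarith
  have hp4' : (p : ℤ) ≤ 4 := by exact_mod_cast hp4
  have hp0 : (0 : ℤ) ≤ p := by positivity
  have hd := BB_det3 hs hpd u v w 5 4 c p q r hu hv hw hp hq hr (by nlinarith)
  have hd1 : (5:ℤ)*4*c+2*p*q*r-(5*(r*r)+4*(q*q)+c*(p*p)) < 1000 := by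
    have hq6' : (q : ℤ) ≤ 5 := by exact_mod_cast Nat.lt_succ_iff.mp hq6
    have e1 : (p : ℤ) * q ≤ 4 * 5 := mul_le_mul hp4' hq6' (by positivity) (by norm_num)
    have e2 : (p : ℤ) * q * r ≤ 4 * 5 * 5 := by
      have : (p : ℤ) * q * r ≤ p * q * 5 := mul_le_mul_of_nonneg_left hr2 (by positivity)
      linarith
    have e3 : (0 : ℤ) ≤ c * (p*p) := by positivity
    nlinarith [mul_self_nonneg r, mul_self_nonneg (q : ℤ)]
  obtain ⟨t, ht, ht', hno⟩ := chkp_sound h q hq6 r hr1 hr2 _ rfl hd hd1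
  obtain ⟨s, hs1, hx⟩ := exists_pos hs hrep u t (by exact_mod_cast ht)
  obtain ⟨x, hx⟩ := Int.eq_ofNat_of_zero_le hx
  have ht'' : (t : ℤ) ≤ 18 := by exact_mod_cast Nat.lt_succ_iff.mp ht'
  have d1 := BB_cs hs hpd u s (by omega)
  have d2 := BB_cs hs hpd v s (by omega)
  have d3 := BB_cs hs hpd w s (by omega)
  rw [hu, hx, hs1] at d1
  rw [hv, hs1] at d2
  rw [hw, hs1] at d3
  refine hno x (by exact_mod_cast d1) (BB M v s) (BB M w s) d2 (by nlinarith) ?_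
  exact BB_det4 hs hk u v w s 5 4 c p q r x _ _ t hu hv hw hp hq hr hx rfl rfl hs1

theorem no_ternary (hs : M.IsSymm) (hpd : QFPosDef M) (hk : k ≤ 3)
    (hrep : ∀ m : ℤ, 4 ≤ m → QFRep M m) : False := by
  obtain ⟨u, hu, -⟩ := exists_pos hs hrep 0 5 (by norm_num)
  obtain ⟨v, hv, hp⟩ := exists_pos hs hrep u 4 (by norm_num)
  obtain ⟨p, hp⟩ := Int.eq_ofNat_of_zero_le hp
  have c1 := BB_cs hs hpd u v (by omega)
  rw [hu, hv, hp] at c1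
  have hp4 : p ≤ 4 := by
    have : (p : ℤ) < 5 := by nlinarith
    omega
  have key := fun c hc hc7 => no_ternary_aux hs hpd hk hrep u v hu hv p c hp hp4 hc hc7
  clear hp c1
  interval_cases p
  · exact key 7 (by norm_num) (by norm_num) chk_0
  · exact key 6 (by norm_num) (by norm_num) chk_1
  · exact key 6 (by norm_num) (by norm_num) chk_2
  · exact key 6 (by norm_num) (by norm_num) chk_3
  · exact key 6 (by norm_num) (by norm_num) chk_4

/-- class modulo two -/
def cl (x : Fin k → ℤ) : Fin k → ZMod 2 := fun i => (x i : ZMod 2)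

theorem cl_eq {x y : Fin k → ℤ} (h : cl x = cl y) : ∃ u, x = y + (2 : ℤ) • u := by
  have h1 : ∀ i, ∃ c, x i = y i + 2 * c := by
    intro i
    have h2 : ((y i : ℤ) : ZMod 2) = (x i : ZMod 2) := (congrFun h i).symm
    rw [ZMod.intCast_eq_intCast_iff_dvd_sub] at h2
    obtain ⟨c, hc⟩ := h2
    exact ⟨c, by push_cast at hc; linarith⟩
  choose u hu using h1
  exact ⟨u, funext fun i => by simp [hu i]⟩

theorem key_pair {n : ℕ} (hs : M.IsSymm) (hmin : ∀ x : Fin k → ℤ, x ≠ 0 → (n : ℤ) ≤ BB M x x)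
    {x y : Fin k → ℤ} (h : cl x = cl y) (h1 : x ≠ y) (h2 : x ≠ -y) :
    ∃ u, x = y + (2 : ℤ) • u ∧ (n : ℤ) ≤ BB M u u ∧ (n : ℤ) ≤ BB M (y + u) (y + u) ∧
      BB M x x + BB M y y = 2 * BB M u u + 2 * BB M (y + u) (y + u) ∧
      (4 : ℤ) ∣ BB M x x - BB M y y := by
  obtain ⟨u, hu⟩ := cl_eq h
  refine ⟨u, hu, hmin u ?_, hmin (y + u) ?_, ?_, ?_⟩
  · rintro rfl; exact h1 (by simp [hu])
  · intro h0
    apply h2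
    have : u = -y := by rw [eq_neg_iff_add_eq_zero, add_comm]; exact h0
    rw [hu, this]; funext i; simp; ring
  · rw [hu]
    simp only [BB_add_left, BB_smul_left, BB_add_right hs, BB_smul_right hs, BB_comm hs u y]
    ring
  · rw [hu]
    simp only [BB_add_left, BB_smul_left, BB_add_right hs, BB_smul_right hs, BB_comm hs u y]
    exact ⟨BB M y u + BB M u u, by ring⟩

theorem big_bound {n : ℕ} (hn : 2 ≤ n) (hs : M.IsSymm)
    (hmin : ∀ x : Fin k → ℤ, x ≠ 0 → (n : ℤ) ≤ BB M x x)
    (hrep : ∀ m : ℕ, n ≤ m → ∃ x : Fin k → ℤ, BB M x x = m) : n + 4 ≤ 2 ^ k := by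
  by_contra hcon
  have hneq : ∀ x y : Fin k → ℤ, BB M x x ≠ BB M y y → x ≠ y ∧ x ≠ -y := by
    intro x y h
    refine ⟨fun e => h (by rw [e]), fun e => h ?_⟩
    have : -y = (-1 : ℤ) • y := by simp
    rw [e, this, BB_smul_left, BB_smul_right hs]; ring
  have hz : BB M (0 : Fin k → ℤ) 0 = 0 := BB_zero_left 0
  -- nonzero class
  have hnz : ∀ x : Fin k → ℤ, 0 < BB M x x → BB M x x < 4 * n → cl x ≠ cl 0 := by
    intro x h0 h4 h
    obtain ⟨h1, h2⟩ := hneq x 0 (by omega)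
    obtain ⟨u, -, e2, e3, e4, -⟩ := key_pair hs hmin h h1 h2
    omega
  have hex : ∀ m : ℕ, ∃ x : Fin k → ℤ, n ≤ m → BB M x x = m := by
    intro m
    by_cases h : n ≤ m
    · obtain ⟨x, hx⟩ := hrep m h
      exact ⟨x, fun _ => hx⟩
    · exact ⟨0, fun h' => absurd h' h⟩
  choose v hv using hex
  set S : Finset (Fin k → ZMod 2) := (Finset.Icc n (2*n+1)).image (fun m => cl (v m)) with hS
  have hinj : Set.InjOn (fun m => cl (v m)) (Finset.Icc n (2*n+1) : Finset ℕ) := by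
    intro m hm m' hm' h
    by_contra hne
    simp only [Finset.coe_Icc, Set.mem_Icc] at hm hm'
    have a1 := hv m hm.1
    have a2 := hv m' hm'.1
    obtain ⟨h1, h2⟩ := hneq (v m) (v m') (by omega)
    obtain ⟨u, -, e2, e3, e4, e5⟩ := key_pair hs hmin h h1 h2
    omega
  have hcard : S.card = n + 2 := by
    rw [hS, Finset.card_image_of_injOn hinj, Nat.card_Icc]; omega
  have h0S : cl 0 ∉ S := by
    intro h
    obtain ⟨m, hm, h⟩ := Finset.mem_image.mp h
    rw [Finset.mem_Icc] at hm
    have a1 := hv m hm.1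
    exact hnz (v m) (by omega) (by omega) h
  have hcard2 : (insert (cl 0) S).card = n + 3 := by
    rw [Finset.card_insert_of_notMem h0S, hcard]
  have hall : insert (cl 0) S = Finset.univ := by
    apply Finset.eq_univ_of_card
    apply le_antisymm (Finset.card_le_univ _)
    rw [hcard2]; simp; omega
  have hclass : ∀ x : Fin k → ℤ, 0 < BB M x x → BB M x x < 4 * n →
      ∃ m, n ≤ m ∧ m ≤ 2 * n + 1 ∧ cl x = cl (v m) := by
    intro x h0 h4
    have h : cl x ∈ insert (cl 0) S := by rw [hall]; exact Finset.mem_univ _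
    rcases Finset.mem_insert.mp h with h | h
    · exact absurd h (hnz x h0 h4)
    · obtain ⟨m, hm, h⟩ := Finset.mem_image.mp h
      rw [Finset.mem_Icc] at hm
      exact ⟨m, hm.1, hm.2, h.symm⟩
  have hmini : ∀ x : Fin k → ℤ, BB M x x = n → x = v n ∨ x = - v n := by
    intro x hx
    by_contra hne
    push Not at hne
    obtain ⟨m, m1, m2, hm⟩ := hclass x (by omega) (by omega)
    have a1 := hv m m1
    by_cases hmn : m = n
    · subst hmn
      obtain ⟨u, -, e2, e3, e4, e5⟩ := key_pair hs hmin hm hne.1 hne.2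
      omega
    · obtain ⟨h1, h2⟩ := hneq x (v m) (by omega)
      obtain ⟨u, -, e2, e3, e4, e5⟩ := key_pair hs hmin hm h1 h2
      omega
  have hw := hv (2*n+2) (by omega)
  obtain ⟨m, m1, m2, hm⟩ := hclass (v (2*n+2)) (by omega) (by omega)
  have a1 := hv m m1
  obtain ⟨h1, h2⟩ := hneq (v (2*n+2)) (v m) (by omega)
  obtain ⟨u, e1, e2, e3, e4, e5⟩ := key_pair hs hmin hm h1 h2
  have b1 := hmini u (by omega)
  have b2 := hmini (v m + u) (by omega)
  have hcase : v m + u = u ∨ v m + u = -u := by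
    rcases b1 with b1 | b1 <;> rcases b2 with b2 | b2 <;> rw [b2] <;> simp [b1]
  rcases hcase with h | h
  · have : v m = 0 := by simpa using h
    rw [this, hz] at a1
    omega
  · have : v (2*n+2) = 0 := by
      rw [e1, two_smul, ← add_assoc, h]; simp
    rw [this, hz] at hw
    omega

end

theorem stmt_17 (n : ℕ) (hn : 0 < n) (k : ℕ) (M : Matrix (Fin k) (Fin k) ℤ)
    (hsym : M.IsSymm) (hpd : QFPosDef M) (ht : QFTight n M) :
    4 ≤ k ∧ n + 4 ≤ 2 ^ k := by
  have hmin : ∀ x : Fin k → ℤ, x ≠ 0 → (n : ℤ) ≤ BB M x x := by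
    intro x hx
    have h := hpd x hx
    exact (ht _ h.ne').mp ⟨x, rfl⟩
  have hrep : ∀ m : ℕ, n ≤ m → ∃ x : Fin k → ℤ, BB M x x = m := by
    intro m hm
    exact (ht m (by omega)).mpr (by exact_mod_cast hm)
  have hbig : 2 ≤ n → n + 4 ≤ 2 ^ k := fun h => big_bound h hsym hmin hrep
  have hk : 4 ≤ k := by
    by_contra hk
    have hk3 : k ≤ 3 := by omega
    have hn4 : n ≤ 4 := by
      by_contra h
      have h1 := hbig (by omega)
      have h2 : 2 ^ k ≤ 2 ^ 3 := Nat.pow_le_pow_right (by norm_num) hk3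
      omega
    refine no_ternary hsym hpd hk3 fun m hm => ?_
    exact (ht m (by omega)).mpr (by omega)
  refine ⟨hk, ?_⟩
  by_cases h : 2 ≤ n
  · exact hbig h
  · have h2 : 2 ^ 4 ≤ 2 ^ k := Nat.pow_le_pow_right (by norm_num) hk
    omega
end

section
/- For any positive integer n, there is no positive definite integral quadratic form in 3 variables that represents every integer greater than or equal to n; that is, no ternary positive definite integral quadratic form is T(n)-universal. -/
theorem aux_recip (p q : ℕ) [Fact p.Prime] [Fact q.Prime] (hq : q % 8 = 7)
    (h : p ≠ 2 → IsSquare (-(q : ZMod p))) : IsSquare (p : ZMod q) := by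
  by_cases hp2 : p = 2
  · subst hp2
    have := (ZMod.exists_sq_eq_two_iff (p := q) (by omega)).2 (Or.inr hq)
    exact_mod_cast this
  have hs := h hp2
  have hodd : p % 2 = 1 := (Fact.out : p.Prime).eq_two_or_odd.resolve_left hp2
  by_cases hpq : p = q
  · subst hpq
    simp
  have h4 : p % 4 = 1 ∨ p % 4 = 3 := by omega
  rcases h4 with h4 | h4
  · have hm : IsSquare (-1 : ZMod p) := ZMod.exists_sq_eq_neg_one_iff.2 (by omega)
    have : IsSquare (q : ZMod p) := by
      have := hm.mul hs
      simpa using this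
    exact (ZMod.exists_sq_eq_prime_iff_of_mod_four_eq_one h4 (by omega)).1 this
  · rw [ZMod.exists_sq_eq_prime_iff_of_mod_four_eq_three (p := q) (q := p) (by omega) h4
      (fun h => hpq h.symm)]
    intro hc
    have hq0 : (q : ZMod p) ≠ 0 := by
      intro h0
      rw [ZMod.natCast_eq_zero_iff] at h0
      exact hpq ((Nat.prime_dvd_prime_iff_eq Fact.out Fact.out).1 h0)
    obtain ⟨r, hr⟩ := hs
    obtain ⟨t, ht⟩ := hc
    have ht0 : t ≠ 0 := by
      rintro rfl
      simp at ht
      exact hq0 ht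
    have : r ^ 2 = -t ^ 2 := by
      rw [pow_two, pow_two, ← hr, ← ht]
    exact ZMod.mod_four_ne_three_of_sq_eq_neg_sq' ht0 this h4

theorem aux_sq (q : ℕ) (N : ℕ) (hN : N ≠ 0)
    (h : ∀ p : ℕ, p.Prime → p ∣ N → IsSquare (p : ZMod q)) : IsSquare (N : ZMod q) := by
  induction N using Nat.recOnMul with
  | zero => exact absurd rfl hN
  | one => simp
  | prime p hp => exact h p hp dvd_rfl
  | mul a b ha hb =>
    push_cast
    have ha0 : a ≠ 0 := by rintro rfl; simp at hN
    have hb0 : b ≠ 0 := by rintro rfl; simp at hN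
    exact (ha ha0 fun p hp hd => h p hp (hd.mul_right _)).mul
      (hb hb0 fun p hp hd => h p hp (hd.mul_left _))

theorem aux_prim (w1 w2 w3 : ℤ) (hw : ¬ (w1 = 0 ∧ w2 = 0 ∧ w3 = 0)) :
    ∃ k u1 u2 u3 z1 z2 z3 : ℤ, k ≠ 0 ∧ w1 = k * u1 ∧ w2 = k * u2 ∧ w3 = k * u3 ∧
      u1 * z1 + u2 * z2 + u3 * z3 = 1 := by
  set k : ℤ := (Int.gcd w1 (Int.gcd w2 w3) : ℤ) with hk
  have h1 : k ∣ w1 := Int.gcd_dvd_left ..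
  have h23 : k ∣ (Int.gcd w2 w3 : ℤ) := Int.gcd_dvd_right ..
  have h2 : k ∣ w2 := h23.trans (Int.gcd_dvd_left ..)
  have h3 : k ∣ w3 := h23.trans (Int.gcd_dvd_right ..)
  have hk0 : k ≠ 0 := by
    intro h0
    rw [h0] at h1 h2 h3
    exact hw ⟨zero_dvd_iff.1 h1, zero_dvd_iff.1 h2, zero_dvd_iff.1 h3⟩
  have e1 := Int.gcd_eq_gcd_ab w1 (Int.gcd w2 w3)
  have e2 := Int.gcd_eq_gcd_ab w2 w3
  obtain ⟨u1, hu1⟩ := h1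
  obtain ⟨u2, hu2⟩ := h2
  obtain ⟨u3, hu3⟩ := h3
  refine ⟨k, u1, u2, u3, Int.gcdA w1 (Int.gcd w2 w3),
    Int.gcdA w2 w3 * Int.gcdB w1 (Int.gcd w2 w3),
    Int.gcdB w2 w3 * Int.gcdB w1 (Int.gcd w2 w3), hk0, hu1, hu2, hu3, ?_⟩
  apply mul_left_cancel₀ hk0
  rw [← hk] at e1
  generalize Int.gcdA w1 (Int.gcd w2 w3) = A at *
  generalize Int.gcdB w1 (Int.gcd w2 w3) = B at *
  generalize Int.gcdA w2 w3 = C at *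
  generalize Int.gcdB w2 w3 = D at *
  linear_combination (-A) * hu1 - C * B * hu2 - D * B * hu3 - e1 - B * e2

theorem aux_core (a b c e g h : ℤ)
    (hpos : ∀ x y z : ℤ, 0 ≤ a*x^2+b*y^2+c*z^2+2*e*y*z+2*g*x*z+2*h*x*y)
    (d : ℤ) (hd : d = a*b*c+2*e*g*h-a*e^2-b*g^2-c*h^2) (hd0 : 0 < d)
    (q : ℕ) [Fact q.Prime] (hq : q % 8 = 7) (hqd : (d : ℤ) ∣ q + 1) (hqlt : ¬ (q : ℤ) ∣ d)
    (v1 v2 v3 : ℤ)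
    (hv : a*v1^2+b*v2^2+c*v3^2+2*e*v2*v3+2*g*v1*v3+2*h*v1*v2 = d * q) : False := by
  have hqp : Prime (q : ℤ) := Nat.prime_iff_prime_int.1 Fact.out
  have hq0 : (0 : ℤ) < q := by exact_mod_cast (Fact.out : q.Prime).pos
  -- choose x
  have hx : ∃ x1 x2 x3 : ℤ, ¬ (q : ℤ) ∣
      (a*v1+h*v2+g*v3)*x1 + (h*v1+b*v2+e*v3)*x2 + (g*v1+e*v2+c*v3)*x3 := by
    by_contra! hc
    have l1 := hc 1 0 0
    have l2 := hc 0 1 0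
    have l3 := hc 0 0 1
    simp only [mul_one, mul_zero, add_zero, zero_add] at l1 l2 l3
    have k1 : (q : ℤ) ∣ v1 := by
      refine (hqp.dvd_or_dvd (?_ : (q : ℤ) ∣ d * v1)).resolve_left hqlt
      have := ((l1.mul_left (b*c-e^2)).add (l2.mul_left (e*g-c*h))).add (l3.mul_left (e*h-b*g))
      refine this.trans (dvd_of_eq ?_)
      rw [hd]; ring
    have k2 : (q : ℤ) ∣ v2 := by
      refine (hqp.dvd_or_dvd (?_ : (q : ℤ) ∣ d * v2)).resolve_left hqlt
      have := ((l1.mul_left (e*g-c*h)).add (l2.mul_left (a*c-g^2))).add (l3.mul_left (g*h-a*e))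
      refine this.trans (dvd_of_eq ?_)
      rw [hd]; ring
    have k3 : (q : ℤ) ∣ v3 := by
      refine (hqp.dvd_or_dvd (?_ : (q : ℤ) ∣ d * v3)).resolve_left hqlt
      have := ((l1.mul_left (e*h-b*g)).add (l2.mul_left (g*h-a*e))).add (l3.mul_left (a*b-h^2))
      refine this.trans (dvd_of_eq ?_)
      rw [hd]; ring
    obtain ⟨r1, rfl⟩ := k1
    obtain ⟨r2, rfl⟩ := k2
    obtain ⟨r3, rfl⟩ := k3
    apply hqlt
    refine ⟨a*r1^2+b*r2^2+c*r3^2+2*e*r2*r3+2*g*r1*r3+2*h*r1*r2, ?_⟩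
    apply mul_right_cancel₀ hq0.ne'
    rw [← hv]; ring
  obtain ⟨x1, x2, x3, hB⟩ := hx
  set B := (a*v1+h*v2+g*v3)*x1 + (h*v1+b*v2+e*v3)*x2 + (g*v1+e*v2+c*v3)*x3 with hBdef
  set F := a*x1^2+b*x2^2+c*x3^2+2*e*x2*x3+2*g*x1*x3+2*h*x1*x2 with hF
  -- Cauchy-Schwarz
  have hdq : 0 < d * q := mul_pos hd0 hq0
  have hCS : 0 ≤ d * q * F - B^2 := by
    have := hpos (d*q*x1 - B*v1) (d*q*x2 - B*v2) (d*q*x3 - B*v3)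
    have h2 : 0 ≤ (d*q) * (d * q * F - B^2) := by
      refine this.trans_eq ?_
      linear_combination (-2 * (d*q) * B) * hBdef + (-(d*q)^2) * hF + B^2 * hv
    exact nonneg_of_mul_nonneg_right h2 hdq
  have hnd : ¬ (q : ℤ) ∣ d * q * F - B^2 := by
    intro hc
    apply hB
    apply hqp.dvd_of_dvd_pow (n := 2)
    have : (q : ℤ) ∣ d * q * F := ⟨d * F, by ring⟩
    simpa using this.sub hc
  have hfs : d * q * F - B^2 = (b*c-e^2)*(v2*x3-v3*x2)^2+(a*c-g^2)*(v3*x1-v1*x3)^2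
      +(a*b-h^2)*(v1*x2-v2*x1)^2+2*(g*h-a*e)*(v3*x1-v1*x3)*(v1*x2-v2*x1)
      +2*(e*h-b*g)*(v2*x3-v3*x2)*(v1*x2-v2*x1)+2*(e*g-c*h)*(v2*x3-v3*x2)*(v3*x1-v1*x3) := by
    rw [← hv]; rw [hF, hBdef]; ring
  obtain ⟨k, u1, u2, u3, z1, z2, z3, hk0, hu1, hu2, hu3, hz⟩ :=
    aux_prim (v2*x3-v3*x2) (v3*x1-v1*x3) (v1*x2-v2*x1) (by
      rintro ⟨w1, w2, w3⟩
      apply hnd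
      rw [hfs, w1, w2, w3]
      simp)
  rw [hu1, hu2, hu3] at hfs
  have horth : u1*v1+u2*v2+u3*v3 = 0 := by
    apply mul_left_cancel₀ hk0
    linear_combination (-v1) * hu1 - v2 * hu2 - v3 * hu3
  set α := (b*c-e^2)*u1^2+(a*c-g^2)*u2^2+(a*b-h^2)*u3^2+2*(g*h-a*e)*u2*u3
      +2*(e*h-b*g)*u1*u3+2*(e*g-c*h)*u1*u2 with hα
  have hkα : d * q * F - B^2 = k^2 * α := by rw [hfs, hα]; ring
  have hα0 : 0 ≤ α := by
    rw [hkα] at hCS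
    exact nonneg_of_mul_nonneg_right hCS (by positivity)
  have hqα : ¬ (q : ℤ) ∣ α := fun hc => hnd (hkα ▸ hc.mul_left _)
  have hqk : ¬ (q : ℤ) ∣ k := fun hc => hnd (by
    rw [hkα, pow_two, mul_assoc]; exact hc.mul_right _)
  have key : ∃ β γ : ℤ, α * γ = β^2 + q * d^2 := by
    set y1 := v2*z3-v3*z2 with hy1
    set y2 := v3*z1-v1*z3 with hy2
    set y3 := v1*z2-v2*z1 with hy3
    set L1 := (b*c-e^2)*u1+(e*g-c*h)*u2+(e*h-b*g)*u3 with hL1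
    set L2 := (e*g-c*h)*u1+(a*c-g^2)*u2+(g*h-a*e)*u3 with hL2
    set L3 := (e*h-b*g)*u1+(g*h-a*e)*u2+(a*b-h^2)*u3 with hL3
    refine ⟨L1*y1+L2*y2+L3*y3, (b*c-e^2)*y1^2+(a*c-g^2)*y2^2+(a*b-h^2)*y3^2+2*(g*h-a*e)*y2*y3
      +2*(e*h-b*g)*y1*y3+2*(e*g-c*h)*y1*y2, ?_⟩
    have t1 : u2*y3-u3*y2 = v1 := by
      rw [hy3, hy2]; linear_combination v1 * hz - z1 * horth
    have t2 : u3*y1-u1*y3 = v2 := by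
      rw [hy3, hy1]; linear_combination v2 * hz - z2 * horth
    have t3 : u1*y2-u2*y1 = v3 := by
      rw [hy1, hy2]; linear_combination v3 * hz - z3 * horth
    clear_value y1 y2 y3
    have : (q : ℤ) * d^2 = d * (d * q) := by ring
    rw [this, ← hv, ← t1, ← t2, ← t3, hα, hL1, hL2, hL3, hd]
    ring
  obtain ⟨β, γ, hβγ⟩ := key
  clear_value α B F
  obtain ⟨N, rfl⟩ := Int.eq_ofNat_of_zero_le hα0
  have hsq : IsSquare (N : ZMod q) := by
    apply aux_sq
    · rintro rfl
      simp at hqα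
    intro p hp hpN
    haveI : Fact p.Prime := ⟨hp⟩
    apply aux_recip p q hq
    intro hp2
    by_cases hpd : (p : ℤ) ∣ d
    · have h1 : (p : ℤ) ∣ q + 1 := hpd.trans hqd
      have h2 : ((q + 1 : ℤ) : ZMod p) = 0 := (ZMod.intCast_zmod_eq_zero_iff_dvd _ _).2 h1
      push_cast at h2
      have : -(q : ZMod p) = 1 := by linear_combination -h2
      rw [this]; simp
    · have hd' : (d : ZMod p) ≠ 0 := fun h0 => hpd ((ZMod.intCast_zmod_eq_zero_iff_dvd _ _).1 h0)
      have hN0 : (N : ZMod p) = 0 := (ZMod.natCast_eq_zero_iff _ _).2 hpN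
      have := congrArg (Int.cast : ℤ → ZMod p) hβγ
      push_cast at this
      rw [hN0] at this
      refine ⟨β / d, ?_⟩
      field_simp
      linear_combination this
  obtain ⟨r, hr⟩ := hsq
  have hE := congrArg (Int.cast : ℤ → ZMod q) hkα
  push_cast at hE
  rw [hr] at hE
  simp only [ZMod.natCast_self, mul_zero, zero_mul, zero_sub] at hE
  have hB' : (B : ZMod q) ≠ 0 := fun h0 => hB ((ZMod.intCast_zmod_eq_zero_iff_dvd _ _).1 h0)
  exact ZMod.mod_four_ne_three_of_sq_eq_neg_sq' (x := (k : ZMod q) * r) hB'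
    (by linear_combination -hE) (by omega)

/-- No ternary positive definite integral quadratic form is `T(n)`-universal. -/
theorem stmt_19 (n : ℕ) (hn : 0 < n) (M : Matrix (Fin 3) (Fin 3) ℤ)
    (hsym : M.IsSymm) (hpd : QFPosDef M) :
    ¬ ∀ m : ℤ, (n : ℤ) ≤ m → QFRep M m := by
  intro hall
  have s1 : M 1 0 = M 0 1 := hsym.apply 0 1
  have s2 : M 2 0 = M 0 2 := hsym.apply 0 2
  have s3 : M 2 1 = M 1 2 := hsym.apply 1 2
  have hval : ∀ x : Fin 3 → ℤ, QFval M x = M 0 0*(x 0)^2+M 1 1*(x 1)^2+M 2 2*(x 2)^2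
      +2*M 1 2*(x 1)*(x 2)+2*M 0 2*(x 0)*(x 2)+2*M 0 1*(x 0)*(x 1) := by
    intro x
    simp only [QFval, Fin.sum_univ_three, s1, s2, s3]
    ring
  generalize M 0 0 = a at *
  generalize M 1 1 = b at *
  generalize M 2 2 = c at *
  generalize M 1 2 = e at *
  generalize M 0 2 = g at *
  generalize M 0 1 = h at *
  have hp : ∀ x y z : ℤ, ¬ (x = 0 ∧ y = 0 ∧ z = 0) →
      0 < a*x^2+b*y^2+c*z^2+2*e*y*z+2*g*x*z+2*h*x*y := by
    intro x y z hne
    have := hpd ![x, y, z] (by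
      intro h0
      exact hne ⟨congrFun h0 0, congrFun h0 1, congrFun h0 2⟩)
    rw [hval] at this
    simpa using this
  have ha : 0 < a := by simpa using hp 1 0 0 (by simp)
  have hab : 0 < a*b-h^2 := by
    have := hp (-h) a 0 (by rintro ⟨-, h0, -⟩; omega)
    have h2 : 0 < a * (a*b-h^2) := by linarith
    exact pos_of_mul_pos_right h2 ha.le
  obtain ⟨d, hd⟩ : ∃ d, d = a*b*c+2*e*g*h-a*e^2-b*g^2-c*h^2 := ⟨_, rfl⟩
  have hd0 : 0 < d := by
    have := hp (e*h-b*g) (g*h-a*e) (a*b-h^2) (by rintro ⟨-, -, h0⟩; omega)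
    have h2 : 0 < (a*b-h^2) * d := by
      refine this.trans_eq ?_
      rw [hd]; ring
    exact pos_of_mul_pos_right h2 hab.le
  have hmod : (8 * d).toNat ≠ 0 := by omega
  obtain ⟨q, hqgt, hqp, hqm⟩ := Nat.forall_exists_prime_gt_and_zmodEq (n + d.toNat)
    (q := (8 * d).toNat) (a := -1) hmod (IsCoprime.neg_left isCoprime_one_left)
  haveI : Fact q.Prime := ⟨hqp⟩
  have hdvd : 8 * d ∣ q + 1 := by
    have := hqm.symm.dvd
    rw [Int.toNat_of_nonneg (by omega)] at this
    simpa using this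
  have h8 : (8 : ℤ) ∣ q + 1 := (Dvd.intro _ rfl).trans hdvd
  have hdd : d ∣ q + 1 := (Dvd.intro_left _ rfl).trans hdvd
  obtain ⟨v, hv⟩ := hall (d * q) (by nlinarith)
  rw [hval] at hv
  refine aux_core a b c e g h ?_ d hd hd0 q (by omega) hdd ?_ _ _ _ hv
  · intro x y z
    by_cases h0 : x = 0 ∧ y = 0 ∧ z = 0
    · obtain ⟨rfl, rfl, rfl⟩ := h0
      simp
    · exact (hp x y z h0).le
  · intro hc
    have := Int.le_of_dvd hd0 hc
    omega
end
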